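/- arXiv:1406.2681 — 4 statements merged into one kernel-verified Lean document; each statement's English description precedes it below -/
import Mathlib

section
/- (Fröhlich's Theorem.) Let 𝓗 be a complex Hilbert space and T a densely defined symmetric operator in 𝓗. Suppose that for every v ∈ dom(T) there exist ε > 0 and a map φ : (0,ε) → dom(T) such that φ is differentiable on (0,ε) with φ'(t) = T(φ(t)) for every t ∈ (0,ε), and φ(t) → v as t → 0⁺. Then T is essentially self-adjoint, i.e. the closure of T is a self-adjoint operator (equivalently, the adjoint of T equals the closure of T). -/
open scoped InnerProductSpace

section LocalSymmetricFlow

variable {H : Type*} [NormedAddCommGroup H] [InnerProductSpace ℂ H]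

theorem inner_eq_inner_zero_add {x : ℕ → H}
    (hx : ∀ n m, ⟪x (n + 1), x m⟫_ℂ = ⟪x n, x (m + 1)⟫_ℂ) (n m : ℕ) :
    ⟪x n, x m⟫_ℂ = ⟪x 0, x (n + m)⟫_ℂ := by
  induction n generalizing m with
  | zero => simp
  | succ n ih => rw [hx, ih, show n + (m + 1) = n + 1 + m by ring]

theorem summable_exp_series_of_norm_le {x : ℕ → H} {C R : ℝ} {z : ℂ}
    (hbound : ∀ n, ‖x n‖ ≤ C * R ^ n * n.factorial) (hC : 0 ≤ C) (hR : 0 ≤ R)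
    (hz : ‖z‖ * R ≤ 1 / 4) (k : ℕ) :
    Summable fun n => ‖(z ^ n / n.factorial) • x (n + k)‖ := by
  refine Summable.of_nonneg_of_le (fun n => norm_nonneg _) (fun n => ?_)
    ((summable_geometric_of_lt_one (by norm_num) (by norm_num : (1 / 2 : ℝ) < 1)).mul_left
      (C * R ^ k * k.factorial * 2 ^ k))
  have hn : (0 : ℝ) < n.factorial := by positivity
  have hk : (0 : ℝ) < k.factorial := by positivity
  have hch : ((n + k).factorial : ℝ) ≤ 2 ^ (n + k) * (n.factorial * k.factorial) := by
    have h := Nat.add_choose_mul_factorial_mul_factorial n k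
    have h2 := Nat.choose_le_two_pow (n + k) k
    rw [← h, mul_assoc]
    exact_mod_cast Nat.mul_le_mul_right _ h2
  rw [norm_smul, norm_div, norm_pow, Complex.norm_natCast]
  calc ‖z‖ ^ n / n.factorial * ‖x (n + k)‖
      ≤ ‖z‖ ^ n / n.factorial * (C * R ^ (n + k) * (2 ^ (n + k) * (n.factorial * k.factorial))) := by
        gcongr
        exact (hbound _).trans (by gcongr)
    _ = C * R ^ k * k.factorial * 2 ^ k * (2 * (‖z‖ * R)) ^ n := by
        rw [pow_add, pow_add, mul_pow, mul_pow]; field_simp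
    _ ≤ C * R ^ k * k.factorial * 2 ^ k * (1 / 2) ^ n := by
        gcongr; linarith

theorem inner_tsum_tsum [CompleteSpace H] {a b : ℕ → H} (ha : Summable fun n => ‖a n‖)
    (hb : Summable fun n => ‖b n‖) :
    ⟪∑' n, a n, ∑' n, b n⟫_ℂ = ∑' N, ∑ p ∈ Finset.HasAntidiagonal.antidiagonal N, ⟪a p.1, b p.2⟫_ℂ := by
  have hs : Summable fun p : ℕ × ℕ => ⟪a p.1, b p.2⟫_ℂ := by
    refine Summable.of_norm_bounded
      (ha.mul_of_nonneg hb (fun _ => norm_nonneg _) fun _ => norm_nonneg _) fun p => ?_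
    exact norm_inner_le_norm _ _
  have h1 (u : H) : ⟪u, ∑' n, b n⟫_ℂ = ∑' n, ⟪u, b n⟫_ℂ :=
    (innerSL ℂ u).map_tsum hb.of_norm
  have h2 (u : H) : ⟪∑' n, a n, u⟫_ℂ = ∑' n, ⟪a n, u⟫_ℂ := by
    have := (innerSL ℂ u).map_tsum ha.of_norm
    simp only [innerSL_apply_apply] at this
    rw [← inner_conj_symm, this, Complex.conj_tsum]
    simp
  simp_rw [h2, h1]
  rw [← hs.tsum_prod, ← Finset.HasAntidiagonal.sigmaAntidiagonalEquivProd.tsum_eq]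
  rw [Summable.tsum_sigma']
  · refine tsum_congr fun N => ?_
    rw [tsum_fintype, ← Finset.sum_coe_sort (Finset.HasAntidiagonal.antidiagonal N)]
    rfl
  · intro N; exact (hasSum_fintype _).summable
  · exact Finset.HasAntidiagonal.sigmaAntidiagonalEquivProd.summable_iff.mpr hs

theorem inner_exp_series [CompleteSpace H] {x : ℕ → H} {z : ℂ}
    (hsymm : ∀ n m, ⟪x (n + 1), x m⟫_ℂ = ⟪x n, x (m + 1)⟫_ℂ)
    (hz : starRingEnd ℂ z = -z)
    (hs : ∀ k, Summable fun n => ‖(z ^ n / n.factorial) • x (n + k)‖) (k l : ℕ) :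
    ⟪∑' n : ℕ, (z ^ n / n.factorial) • x (n + k), ∑' n : ℕ, (z ^ n / n.factorial) • x (n + l)⟫_ℂ
      = ⟪x k, x l⟫_ℂ := by
  rw [inner_tsum_tsum (hs k) (hs l), tsum_eq_single 0]
  · simp
  · intro N hN
    have h : ∀ p ∈ Finset.HasAntidiagonal.antidiagonal N,
        ⟪(z ^ p.1 / p.1.factorial) • x (p.1 + k), (z ^ p.2 / p.2.factorial) • x (p.2 + l)⟫_ℂ
          = (-z) ^ p.1 * z ^ p.2 * (N.choose p.1) *
            (⟪x 0, x (N + k + l)⟫_ℂ / N.factorial) := by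
      rintro ⟨i, j⟩ hp
      obtain rfl := Finset.HasAntidiagonal.mem_antidiagonal.mp hp
      have h1 : ((i + j).choose i : ℂ) * i.factorial * j.factorial = (i + j).factorial := by
        have := Nat.add_choose_mul_factorial_mul_factorial i j
        rw [← Nat.choose_symm_add] at this
        exact_mod_cast this
      have hi : (i.factorial : ℂ) ≠ 0 := by exact_mod_cast i.factorial_ne_zero
      have hj : (j.factorial : ℂ) ≠ 0 := by exact_mod_cast j.factorial_ne_zero
      have hij : ((i + j).factorial : ℂ) ≠ 0 := by exact_mod_cast (i + j).factorial_ne_zero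
      rw [inner_smul_left, inner_smul_right, inner_eq_inner_zero_add hsymm,
        show i + k + (j + l) = i + j + k + l by ring]
      simp only [map_div₀, map_pow, hz, map_natCast]
      field_simp
      rw [← h1]
      ring
    rw [Finset.sum_congr rfl h, ← Finset.sum_mul]
    have := (Commute.all (-z) z).add_pow' N
    rw [neg_add_cancel, zero_pow hN] at this
    rw [Finset.sum_congr rfl (fun p _ => (mul_comm _ _ : (-z) ^ p.1 * z ^ p.2 * (N.choose p.1 : ℂ) = _))]
    simp only [nsmul_eq_mul] at this
    rw [← this, zero_mul]

theorem exists_exp_seq [CompleteSpace H] {x : ℕ → H} {C R : ℝ} {μ : ℂ} {w : H}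
    (hbound : ∀ n, ‖x n‖ ≤ C * R ^ n * n.factorial) (hC : 0 ≤ C) (hR : 0 < R)
    (hsymm : ∀ n m, ⟪x (n + 1), x m⟫_ℂ = ⟪x n, x (m + 1)⟫_ℂ)
    (hμ : μ = Complex.I ∨ μ = -Complex.I)
    (hw : ∀ n, ⟪w, x (n + 1)⟫_ℂ = μ * ⟪w, x n⟫_ℂ) :
    ∃ y : ℕ → H, (∀ k l, ⟪y k, y l⟫_ℂ = ⟪x k, x l⟫_ℂ) ∧
      ∀ k, ⟪w, y k⟫_ℂ = Real.exp (1 / (4 * R)) * ⟪w, x k⟫_ℂ := by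
  set s : ℝ := 1 / (4 * R) with hs_def
  have hs0 : 0 < s := by positivity
  have hμ2 : μ * μ = -1 := by rcases hμ with rfl | rfl <;> simp
  have hμc : starRingEnd ℂ μ = -μ := by rcases hμ with rfl | rfl <;> simp
  have hμn : ‖μ‖ = 1 := by rcases hμ with rfl | rfl <;> simp
  let z : ℂ := -s * μ
  have hz : starRingEnd ℂ z = -z := by simp [z, hμc]
  have hzμ : z * μ = s := by
    simp only [z]; linear_combination (-(s : ℂ)) * hμ2
  have hzn : ‖z‖ * R ≤ 1 / 4 := by
    simp only [z, norm_mul, norm_neg, hμn, Complex.norm_real, Real.norm_of_nonneg hs0.le]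
    rw [hs_def]; field_simp; rfl
  have hsum := summable_exp_series_of_norm_le hbound hC hR.le hzn
  refine ⟨fun k => ∑' n : ℕ, (z ^ n / n.factorial) • x (n + k),
    inner_exp_series hsymm hz hsum, fun k => ?_⟩
  have hwn (n k : ℕ) : ⟪w, x (n + k)⟫_ℂ = μ ^ n * ⟪w, x k⟫_ℂ := by
    induction n with
    | zero => simp
    | succ n ih => rw [show n + 1 + k = n + k + 1 by ring, hw, ih]; ring
  have h1 := (innerSL ℂ w).map_tsum (hsum k).of_norm
  simp only [innerSL_apply_apply, inner_smul_right, hwn] at h1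
  rw [h1, Complex.ofReal_exp, Complex.exp_eq_exp_ℂ, NormedSpace.exp_eq_tsum_div, ← tsum_mul_right,
    ← hzμ]
  refine tsum_congr fun n => ?_
  rw [mul_pow]; ring

theorem exists_exp_seq_iterate [CompleteSpace H] {x : ℕ → H} {C R : ℝ} {μ : ℂ} {w : H}
    (hbound : ∀ n, ‖x n‖ ≤ C * R ^ n * n.factorial) (hC : 0 ≤ C) (hR : 0 < R)
    (hsymm : ∀ n m, ⟪x (n + 1), x m⟫_ℂ = ⟪x n, x (m + 1)⟫_ℂ)
    (hμ : μ = Complex.I ∨ μ = -Complex.I)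
    (hw : ∀ n, ⟪w, x (n + 1)⟫_ℂ = μ * ⟪w, x n⟫_ℂ) (N : ℕ) :
    ∃ y : ℕ → H, (∀ k l, ⟪y k, y l⟫_ℂ = ⟪x k, x l⟫_ℂ) ∧
      ∀ k, ⟪w, y k⟫_ℂ = (Real.exp (1 / (4 * R)) : ℂ) ^ N * ⟪w, x k⟫_ℂ := by
  induction N with
  | zero => exact ⟨x, by simp, by simp⟩
  | succ N ih =>
    obtain ⟨y, hy, hwy⟩ := ih
    have hnorm (k : ℕ) : ‖y k‖ = ‖x k‖ := by
      rw [norm_eq_sqrt_re_inner (𝕜 := ℂ), hy, ← norm_eq_sqrt_re_inner]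
    obtain ⟨y', hy', hwy'⟩ := exists_exp_seq (x := y) (w := w) (μ := μ)
      (fun n => (hnorm n).trans_le (hbound n)) hC hR (fun n m => by rw [hy, hy, hsymm]) hμ
      (fun n => by rw [hwy, hwy, hw]; ring)
    exact ⟨y', fun k l => by rw [hy', hy], fun k => by rw [hwy', hwy, pow_succ]; ring⟩

theorem inner_eq_zero_of_factorial_bound [CompleteSpace H] {x : ℕ → H} {C R : ℝ} {μ : ℂ} {w : H}
    (hbound : ∀ n, ‖x n‖ ≤ C * R ^ n * n.factorial) (hC : 0 ≤ C) (hR : 0 < R)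
    (hsymm : ∀ n m, ⟪x (n + 1), x m⟫_ℂ = ⟪x n, x (m + 1)⟫_ℂ)
    (hμ : μ = Complex.I ∨ μ = -Complex.I)
    (hw : ∀ n, ⟪w, x (n + 1)⟫_ℂ = μ * ⟪w, x n⟫_ℂ) : ⟪w, x 0⟫_ℂ = 0 := by
  by_contra hne
  have hpos : 0 < ‖⟪w, x 0⟫_ℂ‖ := norm_pos_iff.mpr hne
  have hexp : 1 < Real.exp (1 / (4 * R)) := Real.one_lt_exp_iff.mpr (by positivity)
  obtain ⟨N, hN⟩ := pow_unbounded_of_one_lt (‖w‖ * ‖x 0‖ / ‖⟪w, x 0⟫_ℂ‖) hexp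
  obtain ⟨y, hy, hwy⟩ := exists_exp_seq_iterate hbound hC hR hsymm hμ hw N
  have hnorm : ‖y 0‖ = ‖x 0‖ := by
    rw [norm_eq_sqrt_re_inner (𝕜 := ℂ), hy, ← norm_eq_sqrt_re_inner]
  have h := norm_inner_le_norm (𝕜 := ℂ) w (y 0)
  rw [hwy, hnorm, norm_mul, norm_pow, Complex.norm_real, Real.norm_of_nonneg (Real.exp_pos _).le] at h
  rw [div_lt_iff₀ hpos] at hN
  linarith
theorem le_of_hasDerivAt_le {f g f' g' : ℝ → ℝ} {h : ℝ} (hf : ∀ u, HasDerivAt f (f' u) u)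
    (hg : ∀ u, HasDerivAt g (g' u) u) (h0 : f 0 ≤ g 0)
    (hle : ∀ u ∈ Set.Icc 0 h, f' u ≤ g' u) : ∀ u ∈ Set.Icc 0 h, f u ≤ g u := by
  intro u hu
  have hmono : MonotoneOn (g - f) (Set.Icc 0 h) := by
    refine monotoneOn_of_deriv_nonneg (convex_Icc 0 h)
      (fun v _ => ((hg v).sub (hf v)).continuousAt.continuousWithinAt)
      (fun v _ => ((hg v).sub (hf v)).differentiableAt.differentiableWithinAt) fun v hv => ?_
    rw [((hg v).sub (hf v)).deriv]
    exact sub_nonneg.mpr (hle v (interior_subset hv))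
  have := hmono ⟨le_rfl, hu.1.trans hu.2⟩ hu hu.1
  simp only [Pi.sub_apply] at this
  linarith

/-- Bernstein's estimate for functions whose even derivatives are nonnegative. -/
theorem even_deriv_mul_pow_le {G : ℕ → ℝ → ℝ} {h : ℝ}
    (hG : ∀ n u, HasDerivAt (G n) (G (n + 1) u) u) (hh : 0 ≤ h)
    (hpos : ∀ n, ∀ u ∈ Set.Icc (-h) h, 0 ≤ G (2 * n) u) (n : ℕ) :
    2 * G (2 * n) 0 * (h ^ (2 * n) / (2 * n).factorial) ≤ G 0 h + G 0 (-h) := by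
  let E : ℕ → ℝ → ℝ := fun j u => G j u + (-1) ^ j * G j (-u)
  have hE (j : ℕ) (u : ℝ) : HasDerivAt (E j) (E (j + 1) u) u := by
    have h1 := (hG j (-u)).comp u (hasDerivAt_neg u)
    refine ((hG j u).add (h1.const_mul ((-1 : ℝ) ^ j))).congr_deriv ?_
    simp only [E]; ring
  have hEpos (m : ℕ) (u : ℝ) (hu : u ∈ Set.Icc 0 h) : 0 ≤ E (2 * m) u := by
    have h1 := hpos m u ⟨by linarith [hu.1], hu.2⟩
    have h2 := hpos m (-u) ⟨by linarith [hu.2], by linarith [hu.1]⟩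
    simp only [E, pow_mul, neg_one_sq, one_pow, one_mul]
    exact add_nonneg h1 h2
  have hEodd (m : ℕ) : E (2 * m + 1) 0 = 0 := by
    simp [E, pow_succ, pow_mul]
  have hEzero (j : ℕ) : 0 ≤ E j 0 := by
    rcases Nat.even_or_odd' j with ⟨m, rfl | rfl⟩
    · exact hEpos m 0 ⟨le_rfl, hh⟩
    · exact (hEodd m).ge
  have hodd : ∀ u ∈ Set.Icc 0 h, 0 ≤ E (2 * n + 1) u :=
    le_of_hasDerivAt_le (fun u => hasDerivAt_const u (0 : ℝ)) (hE _) (hEodd n).ge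
      fun u hu => hEpos (n + 1) u hu
  have key (i : ℕ) : ∀ j, i + j = 2 * n → ∀ u ∈ Set.Icc 0 h,
      E (2 * n) 0 * (u ^ i / i.factorial) ≤ E j u := by
    induction i with
    | zero =>
      intro j hj u hu
      obtain rfl : j = 2 * n := by omega
      simpa using le_of_hasDerivAt_le (fun u => hasDerivAt_const u (E (2 * n) 0)) (hE _) le_rfl
        hodd u hu
    | succ i ih =>
      intro j hj
      refine le_of_hasDerivAt_le (f' := fun u => E (2 * n) 0 * (u ^ i / i.factorial))
        (fun u => ?_) (hE j) (by simpa using hEzero j) (ih (j + 1) (by omega))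
      have hi : (i.factorial : ℝ) ≠ 0 := by positivity
      refine (((hasDerivAt_pow (i + 1) u).div_const ((i + 1).factorial : ℝ)).const_mul
        (E (2 * n) 0)).congr_deriv ?_
      rw [Nat.factorial_succ]
      push_cast
      field_simp
  have := key (2 * n) 0 (by simp) h ⟨hh, le_rfl⟩
  simp only [E, pow_mul, neg_one_sq, one_pow, one_mul, neg_zero, pow_zero] at this ⊢
  linarith

theorem HasDerivAt.unique_of_eventuallyEq {E : Type*} [NormedAddCommGroup E] [NormedSpace ℝ E]
    {f g : ℝ → E} {f' g' : E} {t : ℝ} (hf : HasDerivAt f f' t) (hg : HasDerivAt g g' t)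
    (h : f =ᶠ[nhds t] g) : f' = g' :=
  hf.unique (hg.congr_of_eventuallyEq h)

theorem HasDerivAt.inner_const_left {f : ℝ → H} {f' : H} {t : ℝ} (u : H)
    (hf : HasDerivAt f f' t) : HasDerivAt (fun s => ⟪u, f s⟫_ℂ) ⟪u, f'⟫_ℂ t := by
  simpa using (hasDerivAt_const t u).inner ℂ hf

theorem HasDerivAt.inner_const_right {f : ℝ → H} {f' : H} {t : ℝ} (u : H)
    (hf : HasDerivAt f f' t) : HasDerivAt (fun s => ⟪f s, u⟫_ℂ) ⟪f', u⟫_ℂ t := by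
  simpa using hf.inner ℂ (hasDerivAt_const t u)

theorem inner_deriv_eq_of_inner_eq {ψ : ℕ → ℝ → H} {δ : ℝ}
    (hψ : ∀ n t, HasDerivAt (ψ n) (ψ (n + 1) t) t)
    (h0 : ∀ s ∈ Set.Ioo (-δ) δ, ∀ t ∈ Set.Ioo (-δ) δ,
      ⟪ψ 0 s, ψ 0 t⟫_ℂ = ⟪ψ 0 0, ψ 0 (s + t)⟫_ℂ) (n m : ℕ) :
    ∀ s ∈ Set.Ioo (-δ) δ, ∀ t ∈ Set.Ioo (-δ) δ,
      ⟪ψ n s, ψ m t⟫_ℂ = ⟪ψ 0 0, ψ (n + m) (s + t)⟫_ℂ := by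
  induction m with
  | zero =>
    induction n with
    | zero => simpa using h0
    | succ n ih =>
      intro s hs t ht
      refine ((hψ n s).inner_const_right (ψ 0 t)).unique_of_eventuallyEq
        (((hψ (n + 0) (s + t)).comp_add_const s t).inner_const_left (ψ 0 0) |>.congr_deriv ?_) ?_
      · rw [show n + 0 + 1 = n + 1 + 0 by ring]
      · filter_upwards [isOpen_Ioo.mem_nhds hs] with s hs using ih s hs t ht
  | succ m ih =>
    intro s hs t ht
    refine ((hψ m t).inner_const_left (ψ n s)).unique_of_eventuallyEq
      (((hψ (n + m) (s + t)).comp_const_add s t).inner_const_left (ψ 0 0)) ?_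
    filter_upwards [isOpen_Ioo.mem_nhds ht] with t ht using ih s hs t ht

theorem inner_deriv_eq_of_inner_eq_exp {ψ : ℕ → ℝ → H} {δ : ℝ} {μ : ℂ} {w : H}
    (hψ : ∀ n t, HasDerivAt (ψ n) (ψ (n + 1) t) t)
    (hw : ∀ t ∈ Set.Ioo (-δ) δ, ⟪w, ψ 0 t⟫_ℂ = Complex.exp (μ * t) * ⟪w, ψ 0 0⟫_ℂ) (n : ℕ) :
    ∀ t ∈ Set.Ioo (-δ) δ, ⟪w, ψ n t⟫_ℂ = μ ^ n * (Complex.exp (μ * t) * ⟪w, ψ 0 0⟫_ℂ) := by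
  induction n with
  | zero => simpa using hw
  | succ n ih =>
    intro t ht
    have h1 : HasDerivAt (fun t : ℝ => Complex.exp (μ * t)) (Complex.exp (μ * t) * (μ * 1)) t :=
      ((hasDerivAt_id (t : ℂ)).const_mul μ).cexp.comp_ofReal
    refine ((hψ n t).inner_const_left w).unique_of_eventuallyEq
      (((h1.mul_const ⟪w, ψ 0 0⟫_ℂ).const_mul (μ ^ n)).congr_deriv (by ring)) ?_
    filter_upwards [isOpen_Ioo.mem_nhds ht] with t ht using ih t ht

theorem norm_deriv_le_factorial {ψ : ℕ → ℝ → H} {δ : ℝ} (hδ : 0 < δ)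
    (hψ : ∀ n t, HasDerivAt (ψ n) (ψ (n + 1) t) t)
    (h0 : ∀ s ∈ Set.Ioo (-δ) δ, ∀ t ∈ Set.Ioo (-δ) δ,
      ⟪ψ 0 s, ψ 0 t⟫_ℂ = ⟪ψ 0 0, ψ 0 (s + t)⟫_ℂ) :
    ∃ C : ℝ, 0 ≤ C ∧ ∀ n, ‖ψ n 0‖ ≤ C * (2 / δ) ^ n * n.factorial := by
  have hrel := inner_deriv_eq_of_inner_eq hψ h0
  let G : ℕ → ℝ → ℝ := fun n u => Complex.re ⟪ψ 0 0, ψ n u⟫_ℂ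
  have hG (n : ℕ) (u : ℝ) : HasDerivAt (G n) (G (n + 1) u) u := by
    exact Complex.reCLM.hasFDerivAt.comp_hasDerivAt u ((hψ n u).inner_const_left (ψ 0 0))
  have hGsq (n : ℕ) (u : ℝ) (hu : u ∈ Set.Icc (-δ) δ) : G (2 * n) u = ‖ψ n (u / 2)‖ ^ 2 := by
    have hu2 : u / 2 ∈ Set.Ioo (-δ) δ := ⟨by linarith [hu.1], by linarith [hu.2]⟩
    have h := hrel n n _ hu2 _ hu2
    rw [add_halves, ← two_mul] at h
    simp only [G, ← h, inner_self_eq_norm_sq_to_K]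
    norm_cast
  have hbern := even_deriv_mul_pow_le hG hδ.le fun n u hu => by rw [hGsq n u hu]; positivity
  have h0mem : (0 : ℝ) ∈ Set.Icc (-δ) δ := ⟨by linarith, hδ.le⟩
  refine ⟨√(G 0 δ + G 0 (-δ)), Real.sqrt_nonneg _, fun n => ?_⟩
  have hn := hbern n
  rw [hGsq n 0 h0mem, zero_div] at hn
  have hK : 0 ≤ G 0 δ + G 0 (-δ) := le_trans (by positivity) hn
  have hfac : ((2 * n).factorial : ℝ) ≤ 4 ^ n * (n.factorial : ℝ) ^ 2 := by
    have h1 := Nat.add_choose_mul_factorial_mul_factorial n n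
    have h2 := Nat.centralBinom_le_four_pow n
    rw [Nat.centralBinom_eq_two_mul_choose] at h2
    rw [← two_mul] at h1
    rw [← h1, mul_assoc, ← sq]
    exact_mod_cast Nat.mul_le_mul_right _ h2
  refine (pow_le_pow_iff_left₀ (norm_nonneg _) (by positivity) two_ne_zero).mp ?_
  have h2n : (0 : ℝ) < (2 * n).factorial := by positivity
  rw [mul_pow, mul_pow, Real.sq_sqrt hK, ← pow_mul, mul_comm n 2, div_pow]
  rw [← mul_div_assoc, div_le_iff₀ h2n] at hn
  have h3 : ‖ψ n 0‖ ^ 2 * δ ^ (2 * n) ≤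
      (G 0 δ + G 0 (-δ)) * (2 ^ (2 * n) * (n.factorial : ℝ) ^ 2) := by
    have : (2 : ℝ) ^ (2 * n) = 4 ^ n := by rw [pow_mul]; norm_num
    rw [this]
    have h4 := mul_le_mul_of_nonneg_left hfac hK
    have h5 : 0 ≤ ‖ψ n 0‖ ^ 2 * δ ^ (2 * n) := by positivity
    linarith
  have hδn : 0 < δ ^ (2 * n) := by positivity
  calc ‖ψ n 0‖ ^ 2 ≤ ((G 0 δ + G 0 (-δ)) * (2 ^ (2 * n) * (n.factorial : ℝ) ^ 2)) / δ ^ (2 * n) :=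
        (le_div_iff₀ hδn).mpr h3
    _ = _ := by ring

theorem inner_eq_zero_of_smooth_flow [CompleteSpace H] {ψ : ℕ → ℝ → H} {δ : ℝ} {μ : ℂ} {w : H}
    (hδ : 0 < δ) (hψ : ∀ n t, HasDerivAt (ψ n) (ψ (n + 1) t) t)
    (h0 : ∀ s ∈ Set.Ioo (-δ) δ, ∀ t ∈ Set.Ioo (-δ) δ,
      ⟪ψ 0 s, ψ 0 t⟫_ℂ = ⟪ψ 0 0, ψ 0 (s + t)⟫_ℂ)
    (hμ : μ = Complex.I ∨ μ = -Complex.I)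
    (hw : ∀ t ∈ Set.Ioo (-δ) δ, ⟪w, ψ 0 t⟫_ℂ = Complex.exp (μ * t) * ⟪w, ψ 0 0⟫_ℂ) :
    ⟪w, ψ 0 0⟫_ℂ = 0 := by
  obtain ⟨C, hC, hbound⟩ := norm_deriv_le_factorial hδ hψ h0
  have hmem : (0 : ℝ) ∈ Set.Ioo (-δ) δ := ⟨by linarith, hδ⟩
  have hwn (n : ℕ) := inner_deriv_eq_of_inner_eq_exp hψ hw n 0 hmem
  refine inner_eq_zero_of_factorial_bound (x := fun n => ψ n 0) hbound hC (by positivity)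
    (fun n m => ?_) hμ fun n => ?_
  · rw [inner_deriv_eq_of_inner_eq hψ h0 _ _ 0 hmem 0 hmem,
      inner_deriv_eq_of_inner_eq hψ h0 _ _ 0 hmem 0 hmem, show n + 1 + m = n + (m + 1) by ring]
  · simp only [hwn (n + 1), hwn n, pow_succ]; ring

section Mollification

open MeasureTheory

variable {Φ : ℝ → H} {f : ℝ → ℝ}

theorem Continuous.integrable_smul_comp_sub (hΦ : Continuous Φ) (hf : Continuous f)
    (hfc : HasCompactSupport f) (t : ℝ) : Integrable fun a => f a • Φ (t - a) :=
  Continuous.integrable_of_hasCompactSupport (by fun_prop) hfc.smul_right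

theorem inner_integral_smul_right [CompleteSpace H] (hΦ : Continuous Φ) (hf : Continuous f)
    (hfc : HasCompactSupport f) (u : H) (t : ℝ) :
    ⟪u, ∫ a, f a • Φ (t - a)⟫_ℂ = ∫ a, f a • ⟪u, Φ (t - a)⟫_ℂ := by
  rw [← integral_inner (hΦ.integrable_smul_comp_sub hf hfc t)]
  simp_rw [inner_smul_right_eq_smul]

theorem inner_integral_smul_left [CompleteSpace H] (hΦ : Continuous Φ) (hf : Continuous f)
    (hfc : HasCompactSupport f) (u : H) (t : ℝ) :
    ⟪∫ a, f a • Φ (t - a), u⟫_ℂ = ∫ a, f a • ⟪Φ (t - a), u⟫_ℂ := by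
  rw [← inner_conj_symm, inner_integral_smul_right hΦ hf hfc, ← integral_conj]
  simp [Complex.real_smul]

theorem inner_eq_zero_of_local_flow [CompleteSpace H] {r : ℝ} {μ : ℂ} {w : H} (hr : 0 < r) (hr1 : r ≤ 1)
    (hΦ : Continuous Φ)
    (hinner : ∀ s ∈ Set.Icc (-r) r, ∀ t ∈ Set.Icc (-r) r, ∀ s' ∈ Set.Icc (-r) r,
      ∀ t' ∈ Set.Icc (-r) r, s + t = s' + t' → ⟪Φ s, Φ t⟫_ℂ = ⟪Φ s', Φ t'⟫_ℂ)
    (hμ : μ = Complex.I ∨ μ = -Complex.I)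
    (hw : ∀ t ∈ Set.Icc (-r) r, ⟪w, Φ t⟫_ℂ = Complex.exp (μ * t) * ⟪w, Φ 0⟫_ℂ) :
    ⟪w, Φ 0⟫_ℂ = 0 := by
  let b : ContDiffBump (0 : ℝ) := ⟨r / 4, r / 2, by linarith, by linarith⟩
  have hbc : Continuous b := b.continuous
  have hbs : HasCompactSupport b := b.hasCompactSupport
  have hsupp (a : ℝ) (ha : b a ≠ 0) : a ∈ Set.Ioo (-(r / 2)) (r / 2) := by
    have h : a ∈ Function.support b := ha
    rw [b.support_eq, Real.ball_eq_Ioo] at h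
    simpa [b] using h
  let Ψ : ℝ → H := fun t => ∫ a, b a • Φ (t - a)
  have hsmooth : ContDiff ℝ (⊤ : ℕ∞) Ψ :=
    hbs.contDiff_convolution_left (ContinuousLinearMap.lsmul ℝ ℝ) b.contDiff
      hΦ.locallyIntegrable
  have hderiv (n : ℕ) (t : ℝ) :
      HasDerivAt (iteratedDeriv n Ψ) (iteratedDeriv (n + 1) Ψ t) t := by
    rw [iteratedDeriv_succ]
    exact (hsmooth.differentiable_iteratedDeriv n (by exact_mod_cast ENat.natCast_lt_top n) t).hasDerivAt
  have hΨinner (s t : ℝ) : ⟪Ψ s, Ψ t⟫_ℂ = ∫ a, b a • ∫ c, b c • ⟪Φ (s - a), Φ (t - c)⟫_ℂ := by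
    simp only [Ψ]
    rw [inner_integral_smul_left hΦ hbc hbs]
    simp_rw [inner_integral_smul_right hΦ hbc hbs]
  have hΨw (t : ℝ) (ht : t ∈ Set.Ioo (-(r / 2)) (r / 2)) : ⟪w, Ψ t⟫_ℂ =
      Complex.exp (μ * t) * (∫ a, b a • (Complex.exp (-(μ * a)))) * ⟪w, Φ 0⟫_ℂ := by
    simp only [Ψ]
    rw [inner_integral_smul_right hΦ hbc hbs, ← integral_const_mul, ← integral_mul_const]
    refine integral_congr_ae (.of_forall fun a => ?_)
    by_cases ha : b a = 0
    · simp [ha]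
    have ha' := hsupp a ha
    simp only [Complex.real_smul]
    rw [hw _ ⟨by linarith [ht.1, ha'.2], by linarith [ht.2, ha'.1]⟩]
    push_cast
    rw [mul_sub, sub_eq_add_neg, Complex.exp_add]
    ring
  have h0mem : (0 : ℝ) ∈ Set.Ioo (-(r / 2)) (r / 2) := ⟨by linarith, by linarith⟩
  have hzero : ⟪w, Ψ 0⟫_ℂ = 0 := by
    have := inner_eq_zero_of_smooth_flow (ψ := fun n => iteratedDeriv n Ψ) (δ := r / 4) (w := w)
      (by linarith) hderiv ?_ hμ ?_
    · simpa using this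
    · intro s hs t ht
      simp only [iteratedDeriv_zero]
      rw [hΨinner, hΨinner]
      refine integral_congr_ae (.of_forall fun a => ?_)
      by_cases ha : b a = 0
      · simp [ha]
      have ha' := hsupp a ha
      simp only
      congr 1
      refine integral_congr_ae (.of_forall fun c => ?_)
      by_cases hc : b c = 0
      · simp [hc]
      have hc' := hsupp c hc
      simp only
      rw [hinner (s - a) ⟨by linarith [hs.1, ha'.2], by linarith [hs.2, ha'.1]⟩
        (t - c) ⟨by linarith [ht.1, hc'.2], by linarith [ht.2, hc'.1]⟩
        (0 - a) ⟨by linarith [ha'.2], by linarith [ha'.1]⟩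
        (s + t - c) ⟨by linarith [hs.1, ht.1, hc'.2], by linarith [hs.2, ht.2, hc'.1]⟩ (by ring)]
    · intro t ht
      simp only [iteratedDeriv_zero]
      rw [hΨw t ⟨by linarith [ht.1], by linarith [ht.2]⟩, hΨw 0 h0mem]
      simp [mul_assoc]
  have hintegral : (∫ a, b a • Complex.exp (-(μ * a))) ≠ 0 := by
    have hint : Integrable fun a : ℝ => b a • Complex.exp (-(μ * a)) :=
      Continuous.integrable_of_hasCompactSupport (by fun_prop) hbs.smul_right
    have hre (a : ℝ) : (b a • Complex.exp (-(μ * a))).re = b a * Real.cos a := by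
      rw [Complex.real_smul, Complex.re_ofReal_mul, Complex.exp_re]
      rcases hμ with rfl | rfl <;> simp
    have hpos : 0 < ∫ a, b a * Real.cos a := by
      have hcont : Continuous fun a => b a * Real.cos a := by fun_prop
      refine hcont.integral_pos_of_hasCompactSupport_nonneg_nonzero (x := 0) hbs.mul_right
        (fun a => ?_) ?_
      · by_cases ha : b a = 0
        · simp [ha]
        have ha' := hsupp a ha
        exact mul_nonneg b.nonneg (Real.cos_nonneg_of_mem_Icc
          ⟨by linarith [ha'.1, Real.pi_gt_three], by linarith [ha'.2, Real.pi_gt_three]⟩)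
      · have : b 0 = 1 := b.one_of_mem_closedBall (by simpa [b] using (by linarith : 0 ≤ r / 4))
        simp [this]
    intro h
    have h2 := integral_re hint
    simp only [RCLike.re_to_complex, hre, h, Complex.zero_re] at h2
    linarith
  have h := hΨw 0 h0mem
  rw [hzero, eq_comm, mul_assoc] at h
  exact (mul_eq_zero.mp ((mul_eq_zero.mp h).resolve_left (Complex.exp_ne_zero _))).resolve_left
    hintegral

end Mollification

theorem inner_flow_eq_inner_flow {φ φ' : ℝ → H} {ε : ℝ}
    (hφ : ∀ t ∈ Set.Ioo 0 ε, HasDerivAt φ (φ' t) t)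
    (hsymm : ∀ s ∈ Set.Ioo 0 ε, ∀ t ∈ Set.Ioo 0 ε, ⟪φ' s, φ t⟫_ℂ = ⟪φ s, φ' t⟫_ℂ)
    {s t s' t' : ℝ} (hs : s ∈ Set.Ioo 0 ε) (ht : t ∈ Set.Ioo 0 ε) (hs' : s' ∈ Set.Ioo 0 ε)
    (ht' : t' ∈ Set.Ioo 0 ε) (h : s + t = s' + t') : ⟪φ s, φ t⟫_ℂ = ⟪φ s', φ t'⟫_ℂ := by
  have hd : ∀ x ∈ Set.Ioo (max 0 (s + t - ε)) (min ε (s + t)),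
      HasDerivAt (fun x => ⟪φ x, φ (s + t - x)⟫_ℂ) 0 x := by
    intro x hx
    obtain ⟨h1, h2⟩ := hx
    rw [max_lt_iff] at h1
    rw [lt_min_iff] at h2
    have hx1 : x ∈ Set.Ioo 0 ε := ⟨h1.1, h2.1⟩
    have hx2 : s + t - x ∈ Set.Ioo 0 ε := ⟨by linarith, by linarith⟩
    refine ((hφ x hx1).inner ℂ ((hφ _ hx2).comp_const_sub (s + t) x)).congr_deriv ?_
    rw [inner_neg_right, hsymm x hx1 _ hx2]; ring
  have hmem {x y : ℝ} (hx : x ∈ Set.Ioo 0 ε) (hy : y ∈ Set.Ioo 0 ε) (hxy : s + t = x + y) :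
      x ∈ Set.Ioo (max 0 (s + t - ε)) (min ε (s + t)) :=
    ⟨max_lt hx.1 (by linarith [hy.2]), lt_min hx.2 (by linarith [hy.1])⟩
  have := isOpen_Ioo.is_const_of_deriv_eq_zero (isPreconnected_Ioo)
    (fun x hx => (hd x hx).differentiableAt.differentiableWithinAt)
    (fun x hx => (hd x hx).deriv) (hmem hs ht rfl) (hmem hs' ht' h)
  simp only [add_sub_cancel_left] at this
  rwa [h, add_sub_cancel_left] at this

theorem inner_flow_eq_exp_mul {φ φ' : ℝ → H} {ε : ℝ} {μ : ℂ} {w : H}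
    (hφ : ∀ t ∈ Set.Ioo 0 ε, HasDerivAt φ (φ' t) t)
    (hw : ∀ t ∈ Set.Ioo 0 ε, ⟪w, φ' t⟫_ℂ = μ * ⟪w, φ t⟫_ℂ)
    {s t : ℝ} (hs : s ∈ Set.Ioo 0 ε) (ht : t ∈ Set.Ioo 0 ε) :
    ⟪w, φ t⟫_ℂ = Complex.exp (μ * (t - s)) * ⟪w, φ s⟫_ℂ := by
  have hd : ∀ x ∈ Set.Ioo 0 ε,
      HasDerivAt (fun x : ℝ => Complex.exp (-μ * x) * ⟪w, φ x⟫_ℂ) 0 x := by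
    intro x hx
    have h1 : HasDerivAt (fun t : ℝ => Complex.exp (-μ * t)) (Complex.exp (-μ * x) * (-μ * 1)) x :=
      ((hasDerivAt_id (x : ℂ)).const_mul (-μ)).cexp.comp_ofReal
    refine (h1.mul ((hφ x hx).inner_const_left w)).congr_deriv ?_
    rw [hw x hx]; ring
  have := isOpen_Ioo.is_const_of_deriv_eq_zero (isPreconnected_Ioo)
    (fun x hx => (hd x hx).differentiableAt.differentiableWithinAt)
    (fun x hx => (hd x hx).deriv) hs ht
  rw [mul_sub, sub_eq_add_neg, Complex.exp_add, ← neg_mul, mul_assoc, this, ← mul_assoc,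
    ← Complex.exp_add]
  simp

theorem inner_flow_eq_zero [CompleteSpace H] {φ φ' : ℝ → H} {ε : ℝ} {μ : ℂ} {w : H}
    (hφ : ∀ t ∈ Set.Ioo 0 ε, HasDerivAt φ (φ' t) t)
    (hsymm : ∀ s ∈ Set.Ioo 0 ε, ∀ t ∈ Set.Ioo 0 ε, ⟪φ' s, φ t⟫_ℂ = ⟪φ s, φ' t⟫_ℂ)
    (hμ : μ = Complex.I ∨ μ = -Complex.I)
    (hw : ∀ t ∈ Set.Ioo 0 ε, ⟪w, φ' t⟫_ℂ = μ * ⟪w, φ t⟫_ℂ)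
    {t₀ : ℝ} (ht₀ : t₀ ∈ Set.Ioo 0 ε) : ⟪w, φ t₀⟫_ℂ = 0 := by
  obtain ⟨ρ, hρ, hball⟩ := Metric.isOpen_iff.mp isOpen_Ioo t₀ ht₀
  set r : ℝ := min (ρ / 2) 1
  have hr : 0 < r := by positivity
  have hrρ : r < ρ := (min_le_left _ _).trans_lt (by linarith)
  have hmem {t : ℝ} (ht : t ∈ Set.Icc (-r) r) : t₀ + t ∈ Set.Ioo 0 ε := by
    apply hball
    rw [Real.ball_eq_Ioo]
    exact ⟨by linarith [ht.1], by linarith [ht.2]⟩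
  have hrr : -r ≤ r := by linarith
  let Φ : ℝ → H := fun t => φ (t₀ + Set.projIcc (-r) r hrr t)
  have hΦ : Continuous Φ := by
    have hc : ContinuousOn φ (Set.Ioo 0 ε) := fun t ht =>
      (hφ t ht).continuousAt.continuousWithinAt
    exact hc.comp_continuous (by fun_prop) fun t => hmem (Set.projIcc (-r) r hrr t).2
  have hΦeq {t : ℝ} (ht : t ∈ Set.Icc (-r) r) : Φ t = φ (t₀ + t) := by
    simp only [Φ, Set.projIcc_of_mem hrr ht]
  have h0 : (0 : ℝ) ∈ Set.Icc (-r) r := ⟨by linarith, hr.le⟩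
  have := inner_eq_zero_of_local_flow (w := w) hr (min_le_right _ _) hΦ ?_ hμ ?_
  · rwa [hΦeq h0, add_zero] at this
  · intro s hs t ht s' hs' t' ht' hst
    rw [hΦeq hs, hΦeq ht, hΦeq hs', hΦeq ht']
    exact inner_flow_eq_inner_flow hφ hsymm (hmem hs) (hmem ht) (hmem hs') (hmem ht')
      (by linarith)
  · intro t ht
    rw [hΦeq ht, hΦeq h0, inner_flow_eq_exp_mul hφ hw (hmem h0) (hmem ht)]
    simp

namespace LinearPMap

/-- A symmetric operator with trivial deficiency spaces is essentially self-adjoint. -/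
theorem adjoint_eq_closure_of_deficiency_trivial [CompleteSpace H] {T : H →ₗ.[ℂ] H}
    (hdense : Dense (T.domain : Set H))
    (hsymm : ∀ u v : T.domain, ⟪T u, (v : H)⟫_ℂ = ⟪(u : H), T v⟫_ℂ)
    (hdef : ∀ μ : ℂ, μ = Complex.I ∨ μ = -Complex.I → ∀ w : H,
      (∀ v : T.domain, ⟪w, T v⟫_ℂ = μ * ⟪w, v⟫_ℂ) → w = 0) :
    T.adjoint = T.closure := by
  have hle : T ≤ T.adjoint := IsFormalAdjoint.le_adjoint hdense fun u v => hsymm u v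
  have hclosed := adjoint_isClosed hdense
  have hclosable : T.IsClosable := hclosed.isClosable.leIsClosable hle
  refine eq_of_eq_graph ?_
  rw [← hclosable.graph_closure_eq_closure_graph]
  refine le_antisymm ?_ (T.graph.topologicalClosure_minimal (le_graph_of_le hle) hclosed)
  rintro ⟨x, y⟩ hxy
  let e := WithLp.prodContinuousLinearEquiv 2 ℂ H H
  let K : Submodule ℂ (WithLp 2 (H × H)) :=
    T.graph.topologicalClosure.comap (e : WithLp 2 (H × H) →ₗ[ℂ] H × H)
  have hK : _root_.IsClosed (K : Set (WithLp 2 (H × H))) :=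
    T.graph.isClosed_topologicalClosure.preimage e.continuous
  have : CompleteSpace K := hK.completeSpace_coe
  obtain ⟨k, hk, horth⟩ :=
    Submodule.HasOrthogonalProjection.exists_orthogonal (K := K) (e.symm (x, y))
  have hk' : e k ∈ T.graph.topologicalClosure := hk
  set p := (x, y) - e k with hp
  have hpadj : p ∈ T.adjoint.graph :=
    sub_mem hxy (T.graph.topologicalClosure_minimal (le_graph_of_le hle) hclosed hk')
  have hadj (v : T.domain) : ⟪p.2, (v : H)⟫_ℂ = ⟪p.1, T v⟫_ℂ := by
    rw [adjoint_graph_eq_graph_adjoint hdense, Submodule.mem_adjoint_iff] at hpadj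
    have := congrArg (starRingEnd ℂ) (sub_eq_zero.mp (hpadj _ _ (T.mem_graph v)))
    simpa using this.symm
  have hperp (v : T.domain) : ⟪p.1, (v : H)⟫_ℂ + ⟪p.2, T v⟫_ℂ = 0 := by
    have hv : e.symm ((v : H), T v) ∈ K :=
      T.graph.le_topologicalClosure (T.mem_graph v)
    have := (Submodule.mem_orthogonal' K _).mp horth _ hv
    rwa [WithLp.prod_inner_apply] at this
  have h1 : p.2 - Complex.I • p.1 = 0 := by
    refine hdef Complex.I (.inl rfl) _ fun v => ?_
    rw [inner_sub_left, inner_sub_left, inner_smul_left, inner_smul_left, Complex.conj_I]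
    linear_combination hperp v - Complex.I * hadj v - ⟪p.1, (v : H)⟫_ℂ * Complex.I_sq
  have h2 : p.2 + Complex.I • p.1 = 0 := by
    refine hdef (-Complex.I) (.inr rfl) _ fun v => ?_
    rw [inner_add_left, inner_add_left, inner_smul_left, inner_smul_left, Complex.conj_I]
    linear_combination hperp v + Complex.I * hadj v - ⟪p.1, (v : H)⟫_ℂ * Complex.I_sq
  have hp2 : p.2 = 0 := by
    have : (2 : ℂ) • p.2 = 0 := by
      rw [two_smul]; calc p.2 + p.2 = (p.2 - Complex.I • p.1) + (p.2 + Complex.I • p.1) := by abel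
        _ = 0 := by rw [h1, h2, add_zero]
    simpa using this
  have hp1 : p.1 = 0 := by simpa [hp2] using h2
  have hp0 : p = 0 := Prod.ext hp1 hp2
  rw [hp, sub_eq_zero] at hp0
  rwa [hp0]

end LinearPMap

end LocalSymmetricFlow

/-- **Fröhlich's Theorem.** A densely defined symmetric operator `T` in a complex Hilbert
space is essentially self-adjoint (its adjoint equals its closure) provided that for every
`v` in the domain of `T` there is an `ε > 0` and a curve `φ : (0, ε) → dom T` solving
`φ'(t) = T (φ t)` with `φ(t) → v` as `t → 0⁺`. -/
theorem frohlich_essentially_selfAdjoint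
    {𝓗 : Type*} [NormedAddCommGroup 𝓗] [InnerProductSpace ℂ 𝓗] [CompleteSpace 𝓗]
    (T : 𝓗 →ₗ.[ℂ] 𝓗)
    (hdense : Dense (T.domain : Set 𝓗))
    (hsym : ∀ u v : T.domain, ⟪T u, (v : 𝓗)⟫_ℂ = ⟪(u : 𝓗), T v⟫_ℂ)
    (hflow : ∀ v : T.domain, ∃ ε > (0 : ℝ), ∃ φ : ℝ → T.domain,
      (∀ t ∈ Set.Ioo (0 : ℝ) ε, HasDerivAt (fun s => (φ s : 𝓗)) (T (φ t)) t) ∧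
      Filter.Tendsto (fun t => (φ t : 𝓗)) (nhdsWithin 0 (Set.Ioi 0)) (nhds (v : 𝓗))) :
    T.adjoint = T.closure := by
  refine LinearPMap.adjoint_eq_closure_of_deficiency_trivial hdense hsym fun μ hμ w hw => ?_
  refine hdense.eq_zero_of_inner_left ℂ fun v hv => ?_
  obtain ⟨ε, hε, φ, hφ, hlim⟩ := hflow ⟨v, hv⟩
  have hzero : ∀ t ∈ Set.Ioo 0 ε, ⟪w, (φ t : 𝓗)⟫_ℂ = 0 := fun t ht =>
    inner_flow_eq_zero (φ' := fun t => T (φ t)) hφ (fun s _ t _ => hsym (φ s) (φ t)) hμ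
      (fun t _ => hw (φ t)) ht
  refine tendsto_nhds_unique (Filter.Tendsto.inner (𝕜 := ℂ) tendsto_const_nhds hlim)
    (tendsto_const_nhds.congr' ?_)
  filter_upwards [Ioo_mem_nhdsGT hε] with t ht using (hzero t ht).symm
end

section
/- (Geometric Fröhlich Theorem, realization form.) Let E be a real Banach space, M ⊆ E an open set, 𝓗 a complex Hilbert space, and k : M → 𝓗 a smooth map whose image is total in 𝓗. Let X : M → E be a smooth vector field such that for every m ∈ M there exist ε_m > 0 and a differentiable curve γ_m : [0, ε_m) → M with γ_m(0) = m and γ_m'(t) = X(γ_m(t)) for all t ∈ [0, ε_m). Assume the kernel K(m,n) := ⟪k(n), k(m)⟫ is X-symmetric, i.e. for all m, n ∈ M the right derivatives at t = 0 satisfy (d/dt)|_{t=0} K(γ_m(t), n) = (d/dt)|_{t=0} K(m, γ_n(t)). Then: (a) for each m the right derivative v_m := (d/dt)|_{t=0} k(γ_m(t)) exists in 𝓗, and there is a well-defined linear operator T on the linear span of {k(m) : m ∈ M} determined by T(k(m)) := v_m; (b) T is symmetric: ⟪T u, w⟫ = ⟪u, T w⟫ for all u, w in this span; (c) T is essentially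 self-adjoint, i.e. the closure of T is a self-adjoint operator in 𝓗. -/
open scoped InnerProductSpace

/-- A function on `[0, R)` that is nonnegative at `0` and has nonnegative derivative is
nonnegative. -/
lemma nonneg_of_hasDerivAt_nonneg {f f' : ℝ → ℝ} {R : ℝ}
    (hf : ∀ r ∈ Set.Ico 0 R, HasDerivAt f (f' r) r) (hf' : ∀ r ∈ Set.Ico 0 R, 0 ≤ f' r)
    (h0 : 0 ≤ f 0) : ∀ r ∈ Set.Ico 0 R, 0 ≤ f r := by
  intro r hr
  have hmono : MonotoneOn f (Set.Ico 0 R) := by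
    apply monotoneOn_of_deriv_nonneg (convex_Ico 0 R)
    · exact fun x hx => (hf x hx).continuousAt.continuousWithinAt
    · exact fun x hx => (hf x (interior_subset hx)).differentiableAt.differentiableWithinAt
    · intro x hx
      rw [(hf x (interior_subset hx)).deriv]
      exact hf' x (interior_subset hx)
  exact h0.trans (hmono ⟨le_rfl, hr.1.trans_lt hr.2⟩ hr hr.1)

/-- **Bernstein's estimate**: if all even derivatives of `g 0` are nonnegative on `(t - R, t + R)`,
its symmetric sum about `t` dominates every even term of its Taylor expansion at `t`. -/
lemma bernstein_even_deriv_bound {t R : ℝ} (n : ℕ) :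
    ∀ g : ℕ → ℝ → ℝ,
      (∀ i, ∀ s ∈ Set.Ioo (t - R) (t + R), HasDerivAt (g i) (g (i + 1) s) s) →
      (∀ i, ∀ s ∈ Set.Ioo (t - R) (t + R), 0 ≤ g (2 * i) s) →
      ∀ r ∈ Set.Ico 0 R,
        2 * g (2 * n) t * r ^ (2 * n) / (2 * n).factorial ≤ g 0 (t + r) + g 0 (t - r) := by
  induction n with
  | zero =>
    intro g hg hpos r hr
    have hmem : ∀ s ∈ Set.Ico 0 R,
        t + s ∈ Set.Ioo (t - R) (t + R) ∧ t - s ∈ Set.Ioo (t - R) (t + R) := by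
      rintro s ⟨hs0, hs⟩
      exact ⟨⟨by linarith, by linarith⟩, ⟨by linarith, by linarith⟩⟩
    have hfirst : ∀ s ∈ Set.Ico 0 R, 0 ≤ g 1 (t + s) - g 1 (t - s) :=
      nonneg_of_hasDerivAt_nonneg (f' := fun s => g 2 (t + s) + g 2 (t - s))
        (fun s hs => by
          have h1 := (hg 1 _ (hmem s hs).1).comp_const_add t s
          have h2 := (hg 1 _ (hmem s hs).2).comp_const_sub t s
          exact (h1.sub h2).congr_deriv (by ring))
        (fun s hs => add_nonneg (hpos 1 _ (hmem s hs).1) (hpos 1 _ (hmem s hs).2)) (by simp)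
    have := nonneg_of_hasDerivAt_nonneg (f := fun s => g 0 (t + s) + g 0 (t - s) - 2 * g 0 t)
        (fun s hs => by
          have h1 := (hg 0 _ (hmem s hs).1).comp_const_add t s
          have h2 := (hg 0 _ (hmem s hs).2).comp_const_sub t s
          exact ((h1.add h2).sub_const (2 * g 0 t)).congr_deriv (by ring))
        hfirst (by simp; linarith) r hr
    simp
    linarith
  | succ n ih =>
    intro g hg hpos r hr
    have hmem : ∀ s ∈ Set.Ico 0 R,
        t + s ∈ Set.Ioo (t - R) (t + R) ∧ t - s ∈ Set.Ioo (t - R) (t + R) := by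
      rintro s ⟨hs0, hs⟩
      exact ⟨⟨by linarith, by linarith⟩, ⟨by linarith, by linarith⟩⟩
    have hsecond := ih (fun i => g (i + 2)) (fun i s hs => hg (i + 2) s hs)
      (fun i s hs => hpos (i + 1) s hs)
    have hpow : ∀ (j : ℕ) (s : ℝ), HasDerivAt
        (fun s : ℝ => 2 * g (2 * n + 2) t * s ^ (j + 1) / (j + 1).factorial)
        (2 * g (2 * n + 2) t * s ^ j / j.factorial) s := by
      intro j s
      refine (((hasDerivAt_pow (j + 1) s).const_mul (2 * g (2 * n + 2) t)).div_const
        ((j + 1).factorial : ℝ)).congr_deriv ?_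
      have : (j.factorial : ℝ) ≠ 0 := by positivity
      rw [Nat.factorial_succ]
      push_cast
      field_simp
    have hfirst := nonneg_of_hasDerivAt_nonneg (f := fun s => g 1 (t + s) - g 1 (t - s) -
          2 * g (2 * n + 2) t * s ^ (2 * n + 1) / (2 * n + 1).factorial)
        (fun s hs => by
          have h1 := (hg 1 _ (hmem s hs).1).comp_const_add t s
          have h2 := (hg 1 _ (hmem s hs).2).comp_const_sub t s
          exact (h1.sub h2).sub (hpow (2 * n) s))
        (fun s hs => by have := hsecond s hs; dsimp at this ⊢; linarith) (by simp)
    have hzero : 0 ≤ g 0 t := hpos 0 t ⟨by linarith [hr.1, hr.2], by linarith [hr.1, hr.2]⟩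
    have := nonneg_of_hasDerivAt_nonneg (f := fun s => g 0 (t + s) + g 0 (t - s) -
          2 * g (2 * n + 2) t * s ^ (2 * n + 2) / (2 * n + 2).factorial)
        (fun s hs => by
          have h1 := (hg 0 _ (hmem s hs).1).comp_const_add t s
          have h2 := (hg 0 _ (hmem s hs).2).comp_const_sub t s
          exact (h1.add h2).sub (hpow (2 * n + 1) s))
        (fun s hs => by have := hfirst s hs; dsimp at this ⊢; linarith) (by simp; linarith) r hr
    simp only [Nat.mul_succ] at this ⊢
    linarith

section Nelson

variable {𝓗 : Type*} [NormedAddCommGroup 𝓗] [InnerProductSpace ℂ 𝓗]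

lemma hasSum_inner_of_summable_norm {ι κ : Type*} {u : ι → 𝓗} {w : κ → 𝓗} {U W : 𝓗}
    (hu : HasSum u U) (hw : HasSum w W) (hun : Summable fun j => ‖u j‖)
    (hwn : Summable fun l => ‖w l‖) :
    HasSum (fun p : ι × κ => ⟪u p.1, w p.2⟫_ℂ) ⟪U, W⟫_ℂ := by
  have hsum : Summable (fun p : ι × κ => ⟪u p.1, w p.2⟫_ℂ) :=
    Summable.of_norm_bounded
      (hun.mul_of_nonneg hwn (fun _ => norm_nonneg _) (fun _ => norm_nonneg _))
      (fun p => norm_inner_le_norm _ _)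
  have hfib := hsum.hasSum.prod_fiberwise
    (fun j => (hw.mapL (innerSL ℂ (u j)) : HasSum (fun l => ⟪u j, w l⟫_ℂ) ⟪u j, W⟫_ℂ))
  have houter : HasSum (fun j => ⟪u j, W⟫_ℂ) ⟪U, W⟫_ℂ := by
    have h := (hu.mapL (innerSL ℂ W)).star
    simpa using h
  rw [← hfib.unique houter]
  exact hsum.hasSum

/-- The `j`-th Taylor coefficient of `τ ↦ exp (i τ)` evaluated at `s`. -/
noncomputable def expCoeff (s : ℝ) (j : ℕ) : ℂ := (Complex.I * s) ^ j / j.factorial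

lemma norm_expCoeff (s : ℝ) (j : ℕ) : ‖expCoeff s j‖ = |s| ^ j / j.factorial := by
  simp [expCoeff]

lemma sum_antidiagonal_conj_expCoeff_mul (s : ℝ) (N : ℕ) :
    ∑ p ∈ Finset.HasAntidiagonal.antidiagonal N, (starRingEnd ℂ) (expCoeff s p.1) * expCoeff s p.2 =
      if N = 0 then 1 else 0 := by
  have hbin := (Commute.all (-(Complex.I * s) : ℂ) (Complex.I * s)).add_pow' N
  have hterm : ∀ p ∈ Finset.HasAntidiagonal.antidiagonal N,
      (starRingEnd ℂ) (expCoeff s p.1) * expCoeff s p.2 = (1 / (N.factorial : ℂ)) *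
        (N.choose p.1 • ((-(Complex.I * s) : ℂ) ^ p.1 * (Complex.I * s) ^ p.2)) := by
    intro p hp
    have hN := Finset.HasAntidiagonal.mem_antidiagonal.mp hp
    have hchoose : (N.choose p.1 : ℂ) * (p.1.factorial * p.2.factorial) = N.factorial := by
      have := Nat.add_choose_mul_factorial_mul_factorial p.1 p.2
      rw [← Nat.choose_symm_add, hN, mul_assoc] at this
      exact_mod_cast this
    have h1 : (p.1.factorial : ℂ) ≠ 0 := by exact_mod_cast Nat.factorial_ne_zero _
    have h2 : (p.2.factorial : ℂ) ≠ 0 := by exact_mod_cast Nat.factorial_ne_zero _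
    have h3 : (N.factorial : ℂ) ≠ 0 := by exact_mod_cast Nat.factorial_ne_zero _
    simp only [expCoeff, map_div₀, map_pow, map_mul, Complex.conj_I, Complex.conj_ofReal,
      map_natCast, nsmul_eq_mul, neg_mul]
    field_simp
    linear_combination (-(-(Complex.I * s) : ℂ) ^ p.1 * (Complex.I * s) ^ p.2) * hchoose
  rw [Finset.sum_congr rfl hterm, ← Finset.mul_sum, ← hbin]
  split_ifs with h
  · simp [h]
  · simp [h]

lemma inner_shift_of_hankel {x : ℕ → 𝓗} (hx : ∀ n l, ⟪x (n + 1), x l⟫_ℂ = ⟪x n, x (l + 1)⟫_ℂ)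
    (n j l : ℕ) : ⟪x (n + j), x l⟫_ℂ = ⟪x n, x (l + j)⟫_ℂ := by
  induction j generalizing l with
  | zero => rfl
  | succ j ih => rw [← add_assoc, hx, ih, add_assoc, add_comm 1 j]

/-- A Hankel sequence of vectors with factorial growth, as produced by the iterates of a symmetric
operator on an analytic vector. -/
structure IsAnalyticHankel (x : ℕ → 𝓗) (C ρ : ℝ) : Prop where
  hankel : ∀ n l, ⟪x (n + 1), x l⟫_ℂ = ⟪x n, x (l + 1)⟫_ℂ
  bound : ∀ n, ‖x n‖ ≤ C * n.factorial / ρ ^ n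

/-- The unitary translation of a Hankel sequence by imaginary time `s`. -/
noncomputable def imaginaryTranslate (x : ℕ → 𝓗) (s : ℝ) (n : ℕ) : 𝓗 :=
  ∑' j, expCoeff s j • x (n + j)

namespace IsAnalyticHankel

variable {x : ℕ → 𝓗} {C ρ s : ℝ}

lemma summable_norm (hx : IsAnalyticHankel x C ρ) (hs : |s| < ρ) (n : ℕ) :
    Summable fun j => ‖expCoeff s j • x (n + j)‖ := by
  have hρ : 0 < ρ := (abs_nonneg s).trans_lt hs
  have hratio : ‖|s| / ρ‖ < 1 := by
    rw [Real.norm_of_nonneg (by positivity)]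
    exact (div_lt_one hρ).mpr hs
  refine Summable.of_nonneg_of_le (fun _ => norm_nonneg _) (fun j => ?_)
    ((summable_choose_mul_geometric_of_norm_lt_one n hratio).mul_left
      (C * n.factorial / ρ ^ n))
  rw [norm_smul, norm_expCoeff]
  refine (mul_le_mul_of_nonneg_left (hx.bound (n + j)) (by positivity)).trans_eq ?_
  have hchoose : ((j + n).choose n : ℝ) * (j.factorial * n.factorial) = (n + j).factorial := by
    have := Nat.add_choose_mul_factorial_mul_factorial j n
    rw [add_comm n j, ← this]
    push_cast
    ring
  have : (j.factorial : ℝ) ≠ 0 := by positivity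
  rw [← hchoose, div_pow, pow_add]
  field_simp

variable [CompleteSpace 𝓗]

lemma hasSum_imaginaryTranslate (hx : IsAnalyticHankel x C ρ) (hs : |s| < ρ) (n : ℕ) :
    HasSum (fun j => expCoeff s j • x (n + j)) (imaginaryTranslate x s n) :=
  (hx.summable_norm hs n).of_norm.hasSum

lemma inner_imaginaryTranslate (hx : IsAnalyticHankel x C ρ) (hs : |s| < ρ) (n l : ℕ) :
    ⟪imaginaryTranslate x s n, imaginaryTranslate x s l⟫_ℂ = ⟪x n, x l⟫_ℂ := by
  have hprod := hasSum_inner_of_summable_norm (hx.hasSum_imaginaryTranslate hs n)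
    (hx.hasSum_imaginaryTranslate hs l) (hx.summable_norm hs n) (hx.summable_norm hs l)
  have hanti := ((Finset.HasAntidiagonal.sigmaAntidiagonalEquivProd (A := ℕ)).hasSum_iff.mpr hprod).sigma
    (fun N => hasSum_fintype _)
  have hterm : ∀ N : ℕ, ∑ p : Finset.HasAntidiagonal.antidiagonal N,
      ((fun p : ℕ × ℕ => ⟪expCoeff s p.1 • x (n + p.1), expCoeff s p.2 • x (l + p.2)⟫_ℂ) ∘
        Finset.HasAntidiagonal.sigmaAntidiagonalEquivProd) ⟨N, p⟩ =
      if N = 0 then ⟪x n, x l⟫_ℂ else 0 := by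
    intro N
    have hcoe := Finset.sum_coe_sort (Finset.HasAntidiagonal.antidiagonal N) (fun p : ℕ × ℕ =>
      ⟪expCoeff s p.1 • x (n + p.1), expCoeff s p.2 • x (l + p.2)⟫_ℂ)
    refine hcoe.trans ?_
    have : ∀ p ∈ Finset.HasAntidiagonal.antidiagonal N,
        ⟪expCoeff s p.1 • x (n + p.1), expCoeff s p.2 • x (l + p.2)⟫_ℂ =
          ((starRingEnd ℂ) (expCoeff s p.1) * expCoeff s p.2) * ⟪x n, x (l + N)⟫_ℂ := by
      intro p hp
      rw [inner_smul_left, inner_smul_right, inner_shift_of_hankel hx.hankel, add_assoc, add_comm p.2 p.1,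
        Finset.HasAntidiagonal.mem_antidiagonal.mp hp, mul_assoc]
    rw [Finset.sum_congr rfl this, ← Finset.sum_mul, sum_antidiagonal_conj_expCoeff_mul]
    split_ifs with h
    · simp [h]
    · simp
  simp only [hterm] at hanti
  exact hanti.unique (hasSum_ite_eq 0 _)

lemma norm_imaginaryTranslate (hx : IsAnalyticHankel x C ρ) (hs : |s| < ρ) (n : ℕ) :
    ‖imaginaryTranslate x s n‖ = ‖x n‖ := by
  rw [@norm_eq_sqrt_re_inner ℂ, @norm_eq_sqrt_re_inner ℂ, hx.inner_imaginaryTranslate hs]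

lemma translate (hx : IsAnalyticHankel x C ρ) (hs : |s| < ρ) :
    IsAnalyticHankel (imaginaryTranslate x s) C ρ where
  hankel n l := by
    rw [hx.inner_imaginaryTranslate hs, hx.inner_imaginaryTranslate hs, hx.hankel]
  bound n := (hx.norm_imaginaryTranslate hs n).trans_le (hx.bound n)

lemma inner_translate_of_eigen (hx : IsAnalyticHankel x C ρ) (hs : |s| < ρ) {f : 𝓗} {z : ℂ}
    (hf : ∀ n, ⟪f, x (n + 1)⟫_ℂ = z * ⟪f, x n⟫_ℂ) (n : ℕ) :
    ⟪f, imaginaryTranslate x s n⟫_ℂ = Complex.exp (Complex.I * s * z) * ⟪f, x n⟫_ℂ := by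
  have hpow : ∀ j, ⟪f, x (n + j)⟫_ℂ = z ^ j * ⟪f, x n⟫_ℂ := by
    intro j
    induction j with
    | zero => simp
    | succ j ih => rw [← add_assoc, hf, ih, pow_succ']; ring
  have h1 : HasSum (fun j => ⟪f, expCoeff s j • x (n + j)⟫_ℂ) ⟪f, imaginaryTranslate x s n⟫_ℂ :=
    (hx.hasSum_imaginaryTranslate hs n).mapL (innerSL ℂ f)
  have h2 := (NormedSpace.expSeries_div_hasSum_exp (Complex.I * s * z)).mul_right ⟪f, x n⟫_ℂ
  rw [← Complex.exp_eq_exp_ℂ] at h2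
  refine h1.unique (h2.congr_fun fun j => ?_)
  rw [inner_smul_right, hpow, expCoeff]
  ring

/-- **Nelson's argument**: a vector implementing a nonreal eigenvalue on an analytic Hankel
sequence is orthogonal to it. -/
theorem inner_eq_zero_of_eigen (hx : IsAnalyticHankel x C ρ) (hρ : 0 < ρ) {f : 𝓗} {z : ℂ}
    (hz : z.im ≠ 0) (hf : ∀ n, ⟪f, x (n + 1)⟫_ℂ = z * ⟪f, x n⟫_ℂ) : ⟪f, x 0⟫_ℂ = 0 := by
  obtain ⟨s, hs, hgrow⟩ : ∃ s : ℝ, |s| < ρ ∧ 0 < -(s * z.im) := by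
    rcases lt_or_gt_of_ne hz with h | h
    · exact ⟨ρ / 2, by rw [abs_of_pos (by linarith)]; linarith, by nlinarith⟩
    · exact ⟨-(ρ / 2), by rw [abs_neg, abs_of_pos (by linarith)]; linarith, by nlinarith⟩
  set q : ℝ := Real.exp (-(s * z.im)) with hq
  have hnorm : ‖Complex.exp (Complex.I * s * z)‖ = q := by
    rw [Complex.norm_exp, hq]
    congr 1
    simp [Complex.mul_re, Complex.mul_im]
  have hiter : ∀ N : ℕ, ∀ y : ℕ → 𝓗, IsAnalyticHankel y C ρ →
      (∀ n, ⟪f, y (n + 1)⟫_ℂ = z * ⟪f, y n⟫_ℂ) → q ^ N * ‖⟪f, y 0⟫_ℂ‖ ≤ ‖f‖ * ‖y 0‖ := by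
    intro N
    induction N with
    | zero => intro y _ _; simpa using norm_inner_le_norm f (y 0)
    | succ N ih =>
      intro y hy hfy
      have h := ih _ (hy.translate hs) (fun n => by
        rw [hy.inner_translate_of_eigen hs hfy, hy.inner_translate_of_eigen hs hfy, hfy]; ring)
      rw [hy.inner_translate_of_eigen hs hfy, hy.norm_imaginaryTranslate hs, norm_mul, hnorm] at h
      rwa [pow_succ, mul_assoc]
  by_contra hne
  have hpos : 0 < ‖⟪f, x 0⟫_ℂ‖ := norm_pos_iff.mpr hne
  obtain ⟨N, hN⟩ := pow_unbounded_of_one_lt (‖f‖ * ‖x 0‖ / ‖⟪f, x 0⟫_ℂ‖)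
    (Real.one_lt_exp_iff.mpr hgrow)
  rw [div_lt_iff₀ hpos] at hN
  exact absurd (hiter N x hx hf) (not_le.mpr hN)

end IsAnalyticHankel

/-- **Widder-type analyticity**: a smooth local flow line of a symmetric operator is analytic in
the interior of its interval of definition. -/
theorem exists_isAnalyticHankel_of_hasDerivAt {φ : ℕ → ℝ → 𝓗} {a b : ℝ}
    (hφ : ∀ n, ∀ t ∈ Set.Ioo a b, HasDerivAt (φ n) (φ (n + 1) t) t)
    (hsymm : ∀ t ∈ Set.Ioo a b, ∀ n l, ⟪φ (n + 1) t, φ l t⟫_ℂ = ⟪φ n t, φ (l + 1) t⟫_ℂ)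
    {t : ℝ} (ht : t ∈ Set.Ioo a b) :
    ∃ C ρ, 0 < ρ ∧ IsAnalyticHankel (fun n => φ n t) C ρ := by
  obtain ⟨R, hR, hsub⟩ : ∃ R, 0 < R ∧ Set.Ioo (t - R) (t + R) ⊆ Set.Ioo a b :=
    ⟨min (t - a) (b - t), lt_min (by linarith [ht.1]) (by linarith [ht.2]),
      Set.Ioo_subset_Ioo (by linarith [min_le_left (t - a) (b - t)])
        (by linarith [min_le_right (t - a) (b - t)])⟩
  set g : ℕ → ℝ → ℝ := fun n s => 2 ^ n * (⟪φ 0 s, φ n s⟫_ℂ).re with hgdef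
  have hg : ∀ n, ∀ s ∈ Set.Ioo (t - R) (t + R), HasDerivAt (g n) (g (n + 1) s) s := by
    intro n s hs
    have hinner := (hφ 0 s (hsub hs)).inner ℂ (hφ n s (hsub hs))
    have hre := (Complex.reCLM.hasFDerivAt.comp_hasDerivAt s hinner).const_mul (2 ^ n : ℝ)
    refine hre.congr_deriv ?_
    rw [hsymm s (hsub hs) 0 n]
    simp only [hgdef, Complex.reCLM_apply, Complex.add_re, pow_succ]
    ring
  have heven : ∀ n, ∀ s ∈ Set.Ioo (t - R) (t + R), g (2 * n) s = 4 ^ n * ‖φ n s‖ ^ 2 := by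
    intro n s hs
    have h := inner_shift_of_hankel (x := fun i => φ i s) (hsymm s (hsub hs)) 0 n n
    rw [zero_add, ← two_mul, inner_self_eq_norm_sq_to_K] at h
    simp only [hgdef, ← h, pow_mul]
    norm_num
    norm_cast
  have hbern := fun n => bernstein_even_deriv_bound n g hg
    (fun n s hs => by rw [heven n s hs]; positivity) (R / 2) ⟨by linarith, by linarith⟩
  have hcenter : t ∈ Set.Ioo (t - R) (t + R) := ⟨by linarith, by linarith⟩
  set B := g 0 (t + R / 2) + g 0 (t - R / 2)
  refine ⟨√B, R / 2, by linarith, hsymm t ht, fun n => ?_⟩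
  have hfact : ((2 * n).factorial : ℝ) ≤ 4 ^ n * (n.factorial : ℝ) ^ 2 := by
    have h1 := Nat.centralBinom_le_four_pow n
    have h2 := Nat.add_choose_mul_factorial_mul_factorial n n
    rw [← two_mul, ← Nat.centralBinom_eq_two_mul_choose] at h2
    have : (2 * n).factorial ≤ 4 ^ n * n.factorial ^ 2 := by
      rw [← h2, mul_assoc, ← sq]
      exact Nat.mul_le_mul_right _ h1
    exact_mod_cast this
  have hB := hbern n
  rw [heven n t hcenter, div_le_iff₀ (by positivity)] at hB
  have hB0 : 0 ≤ B := by
    have := hbern 0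
    rw [heven 0 t hcenter] at this
    exact le_trans (by positivity) this
  have hsq : ‖φ n t‖ ^ 2 ≤ (√B * n.factorial / (R / 2) ^ n) ^ 2 := by
    rw [div_pow, mul_pow, Real.sq_sqrt hB0, le_div_iff₀ (by positivity)]
    have h4 : (0 : ℝ) < 4 ^ n := by positivity
    refine le_of_mul_le_mul_left ?_ h4
    have h5 := mul_le_mul_of_nonneg_left hfact hB0
    have h6 : 0 ≤ 4 ^ n * (‖φ n t‖ ^ 2 * ((R / 2) ^ n) ^ 2) := by positivity
    have h7 : (R / 2) ^ (2 * n) = ((R / 2) ^ n) ^ 2 := by rw [← pow_mul, mul_comm]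
    rw [h7] at hB
    linarith
  exact le_of_sq_le_sq hsq (by positivity)

end Nelson

section EssentialSelfAdjointness

variable {𝓗 : Type*} [NormedAddCommGroup 𝓗] [InnerProductSpace ℂ 𝓗]

lemma Submodule.inner_symm_topologicalClosure {G : Submodule ℂ (𝓗 × 𝓗)}
    (hG : ∀ p ∈ G, ∀ q ∈ G, ⟪p.1, q.2⟫_ℂ = ⟪p.2, q.1⟫_ℂ) :
    ∀ p ∈ G.topologicalClosure, ∀ q ∈ G.topologicalClosure, ⟪p.1, q.2⟫_ℂ = ⟪p.2, q.1⟫_ℂ := by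
  intro p hp q hq
  have hclosed : IsClosed {x : (𝓗 × 𝓗) × (𝓗 × 𝓗) | ⟪x.1.1, x.2.2⟫_ℂ = ⟪x.1.2, x.2.1⟫_ℂ} :=
    isClosed_eq (by fun_prop) (by fun_prop)
  have hsub : (G : Set (𝓗 × 𝓗)) ×ˢ (G : Set (𝓗 × 𝓗)) ⊆
      {x | ⟪x.1.1, x.2.2⟫_ℂ = ⟪x.1.2, x.2.1⟫_ℂ} := fun x hx => hG _ hx.1 _ hx.2
  have hmem : (p, q) ∈ closure ((G : Set (𝓗 × 𝓗)) ×ˢ (G : Set (𝓗 × 𝓗))) := by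
    rw [closure_prod_eq]
    exact ⟨hp, hq⟩
  exact closure_minimal hsub hclosed hmem

/-- The range condition behind von Neumann's criterion: if a symmetric relation has no eigenvector
of its adjoint at `Complex.I`, then `T - i` maps its closure onto the whole space. -/
lemma exists_sub_I_smul_eq [CompleteSpace 𝓗] {G : Submodule ℂ (𝓗 × 𝓗)}
    (hG : ∀ p ∈ G, ∀ q ∈ G, ⟪p.1, q.2⟫_ℂ = ⟪p.2, q.1⟫_ℂ)
    (hdef : ∀ f : 𝓗, (∀ p ∈ G, ⟪f, p.2⟫_ℂ = Complex.I * ⟪f, p.1⟫_ℂ) → f = 0) (y : 𝓗) :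
    ∃ p ∈ G.topologicalClosure, p.2 - Complex.I • p.1 = y := by
  let L : 𝓗 × 𝓗 →L[ℂ] 𝓗 :=
    ContinuousLinearMap.snd ℂ 𝓗 𝓗 - Complex.I • ContinuousLinearMap.fst ℂ 𝓗 𝓗
  let LG : G.topologicalClosure →L[ℂ] 𝓗 := L.comp G.topologicalClosure.subtypeL
  have hnorm : ∀ p : G.topologicalClosure, ‖p‖ ≤ ((1 : NNReal) : ℝ) * ‖LG p‖ := by
    rintro ⟨p, hp⟩
    have hs := Submodule.inner_symm_topologicalClosure hG p hp p hp
    have hre : RCLike.re ⟪p.2, Complex.I • p.1⟫_ℂ = 0 := by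
      have him : (⟪p.2, p.1⟫_ℂ).im = 0 := by
        rw [← Complex.conj_eq_iff_im, inner_conj_symm, hs]
      rw [inner_smul_right]
      simp [him]
    have hsq : ‖LG ⟨p, hp⟩‖ ^ 2 = ‖p.2‖ ^ 2 + ‖p.1‖ ^ 2 := by
      change ‖p.2 - Complex.I • p.1‖ ^ 2 = _
      rw [@norm_sub_sq ℂ, hre, norm_smul]
      simp
    rw [NNReal.coe_one, one_mul]
    change max ‖p.1‖ ‖p.2‖ ≤ _
    refine max_le ?_ ?_ <;> refine le_of_sq_le_sq ?_ (norm_nonneg _) <;> rw [hsq] <;>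
      nlinarith [sq_nonneg ‖p.1‖, sq_nonneg ‖p.2‖]
  have : CompleteSpace G.topologicalClosure :=
    (Submodule.isClosed_topologicalClosure G).completeSpace_coe
  have hanti : AntilipschitzWith 1 LG := ContinuousLinearMap.antilipschitz_of_bound LG hnorm
  have hclosed : IsClosed (LG.range : Set 𝓗) := by
    exact hanti.isClosed_range LG.uniformContinuous
  have : CompleteSpace LG.range := hclosed.completeSpace_coe
  have htop : LG.range = ⊤ := by
    rw [← Submodule.orthogonal_eq_bot_iff, Submodule.eq_bot_iff]
    intro f hf
    refine hdef f fun p hp => ?_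
    have hmem : L p ∈ LG.range := ⟨⟨p, G.le_topologicalClosure hp⟩, rfl⟩
    have h0 := Submodule.inner_left_of_mem_orthogonal hmem hf
    change ⟪f, p.2 - Complex.I • p.1⟫_ℂ = 0 at h0
    rwa [inner_sub_right, inner_smul_right, sub_eq_zero] at h0
  obtain ⟨p, hp⟩ := LinearMap.range_eq_top.mp htop y
  exact ⟨p, p.2, hp⟩

/-- **Von Neumann's criterion**: a densely defined symmetric operator whose adjoint does not have
the eigenvalues `±i` is essentially self-adjoint. -/
theorem LinearPMap.adjoint_eq_closure_of_deficiency [CompleteSpace 𝓗] {T : 𝓗 →ₗ.[ℂ] 𝓗}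
    (hT : Dense (T.domain : Set 𝓗)) (hsymm : T.IsFormalAdjoint T)
    (hdef : ∀ z : ℂ, z = Complex.I ∨ z = -Complex.I →
      ∀ f : 𝓗, (∀ x : T.domain, ⟪f, T x⟫_ℂ = z * ⟪f, (x : 𝓗)⟫_ℂ) → f = 0) :
    T.adjoint = T.closure := by
  have hle : T ≤ T.adjoint := hsymm.le_adjoint hT
  have hadj := T.adjoint_isClosed hT
  have hclosable : T.IsClosable := hadj.isClosable.leIsClosable hle
  have hcl : T.graph.topologicalClosure ≤ T.adjoint.graph :=
    Submodule.topologicalClosure_minimal _ (LinearPMap.le_graph_of_le hle) hadj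
  apply LinearPMap.eq_of_eq_graph
  rw [← hclosable.graph_closure_eq_closure_graph]
  refine le_antisymm ?_ hcl
  have hgraph : ∀ p ∈ T.graph, ∀ q ∈ T.graph, ⟪p.1, q.2⟫_ℂ = ⟪p.2, q.1⟫_ℂ := by
    intro p hp q hq
    obtain ⟨u, hu1, hu2⟩ := (LinearPMap.mem_graph_iff T).mp hp
    obtain ⟨w, hw1, hw2⟩ := (LinearPMap.mem_graph_iff T).mp hq
    rw [← hu1, ← hu2, ← hw1, ← hw2]
    exact (hsymm u w).symm
  intro q hq
  obtain ⟨p, hp, hpq⟩ := exists_sub_I_smul_eq hgraph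
    (fun f hf => hdef _ (Or.inl rfl) f fun x => hf _ (T.mem_graph x)) (q.2 - Complex.I • q.1)
  have hmem : q - p ∈ T.adjoint.graph := sub_mem hq (hcl hp)
  have hsnd : (q - p).2 = Complex.I • (q - p).1 := by
    rw [Prod.snd_sub, Prod.fst_sub, smul_sub, sub_eq_sub_iff_sub_eq_sub]
    exact hpq.symm
  obtain ⟨y, hy1, hy2⟩ := (LinearPMap.mem_graph_iff _).mp hmem
  have hzero : (q - p).1 = 0 := by
    refine hdef _ (Or.inr rfl) _ fun x => ?_
    have := T.adjoint_isFormalAdjoint hT y x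
    rw [hy1, hy2, hsnd, inner_smul_left] at this
    rw [← this, Complex.conj_I]
  have : q = p := sub_eq_zero.mp (Prod.ext hzero (by rw [hsnd, hzero, smul_zero]; rfl))
  exact this ▸ hp

end EssentialSelfAdjointness

section LieDerivative

variable {E : Type*} [NormedAddCommGroup E] [NormedSpace ℝ E]

/-- The iterated Lie derivatives of a vector-valued map `k` along a vector field `X`. -/
noncomputable def iteratedLieDeriv {F : Type*} [NormedAddCommGroup F] [NormedSpace ℝ F]
    (X : E → E) (k : E → F) : ℕ → E → F
  | 0 => k
  | n + 1 => fun m => fderiv ℝ (iteratedLieDeriv X k n) m (X m)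

lemma contDiffOn_iteratedLieDeriv {F : Type*} [NormedAddCommGroup F] [NormedSpace ℝ F] {M : Set E}
    (hM : IsOpen M) {X : E → E} (hX : ContDiffOn ℝ (⊤ : ℕ∞) X M) {k : E → F}
    (hk : ContDiffOn ℝ (⊤ : ℕ∞) k M) (n : ℕ) :
    ContDiffOn ℝ (⊤ : ℕ∞) (iteratedLieDeriv X k n) M := by
  induction n with
  | zero => exact hk
  | succ n ih => exact (ih.fderiv_of_isOpen hM (by simp)).clm_apply hX

lemma hasFDerivAt_iteratedLieDeriv {F : Type*} [NormedAddCommGroup F] [NormedSpace ℝ F] {M : Set E}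
    (hM : IsOpen M) {X : E → E} (hX : ContDiffOn ℝ (⊤ : ℕ∞) X M) {k : E → F}
    (hk : ContDiffOn ℝ (⊤ : ℕ∞) k M) (n : ℕ) {m : E} (hm : m ∈ M) :
    HasFDerivAt (iteratedLieDeriv X k n) (fderiv ℝ (iteratedLieDeriv X k n) m) m :=
  (((contDiffOn_iteratedLieDeriv hM hX hk n).differentiableOn (by simp)).differentiableAt
    (hM.mem_nhds hm)).hasFDerivAt

variable {𝓗 : Type*} [NormedAddCommGroup 𝓗] [InnerProductSpace ℂ 𝓗]

lemma HasFDerivAt.inner_left_apply {g : E → 𝓗} {g' : E →L[ℝ] 𝓗} {m : E} (hg : HasFDerivAt g g' m)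
    (f : 𝓗) : HasFDerivAt (fun m => ⟪f, g m⟫_ℂ)
      (((innerSL ℂ f).restrictScalars ℝ).comp g') m :=
  ((innerSL ℂ f).restrictScalars ℝ).hasFDerivAt.comp m hg

/-- A proportionality between matrix coefficients on an open set is inherited by all directional
derivatives. -/
lemma inner_fderiv_eq_of_inner_eq {M : Set E} (hM : IsOpen M) {f f' : 𝓗} {z : ℂ} {g g' : E → 𝓗}
    (h : ∀ m ∈ M, ⟪f, g m⟫_ℂ = z * ⟪f', g' m⟫_ℂ) {m : E} (hm : m ∈ M)
    (hg : HasFDerivAt g (fderiv ℝ g m) m) (hg' : HasFDerivAt g' (fderiv ℝ g' m) m) (v : E) :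
    ⟪f, fderiv ℝ g m v⟫_ℂ = z * ⟪f', fderiv ℝ g' m v⟫_ℂ := by
  have h1 := hg.inner_left_apply f
  have h2 := (hg'.inner_left_apply f').const_mul z
  have heq : (fun m => ⟪f, g m⟫_ℂ) =ᶠ[nhds m] fun m => z * ⟪f', g' m⟫_ℂ :=
    Filter.eventually_of_mem (hM.mem_nhds hm) h
  have := DFunLike.congr_fun (h1.unique (h2.congr_of_eventuallyEq heq)) v
  simpa using this

variable {M : Set E} (hM : IsOpen M) {X : E → E} (hX : ContDiffOn ℝ (⊤ : ℕ∞) X M) {k : E → 𝓗}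
    (hk : ContDiffOn ℝ (⊤ : ℕ∞) k M)

include hM hX hk

lemma inner_iteratedLieDeriv_symm
    (h0 : ∀ m ∈ M, ∀ p ∈ M,
      ⟪iteratedLieDeriv X k 1 m, k p⟫_ℂ = ⟪k m, iteratedLieDeriv X k 1 p⟫_ℂ) (n l : ℕ) :
    ∀ m ∈ M, ∀ p ∈ M, ⟪iteratedLieDeriv X k (n + 1) m, iteratedLieDeriv X k l p⟫_ℂ =
      ⟪iteratedLieDeriv X k n m, iteratedLieDeriv X k (l + 1) p⟫_ℂ := by
  induction n with
  | zero =>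
    induction l with
    | zero => exact h0
    | succ l ih =>
      intro m hm p hp
      have := inner_fderiv_eq_of_inner_eq (z := 1) hM
        (fun p hp => (ih m hm p hp).trans (one_mul _).symm) hp
        (hasFDerivAt_iteratedLieDeriv hM hX hk l hp)
        (hasFDerivAt_iteratedLieDeriv hM hX hk (l + 1) hp) (X p)
      rwa [one_mul] at this
  | succ n ih =>
    intro m hm p hp
    have := inner_fderiv_eq_of_inner_eq (z := 1) hM
      (f := iteratedLieDeriv X k l p) (f' := iteratedLieDeriv X k (l + 1) p)
      (g := iteratedLieDeriv X k (n + 1)) (g' := iteratedLieDeriv X k n)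
      (fun m hm => by
        rw [one_mul, ← inner_conj_symm, ih m hm p hp, inner_conj_symm]) hm
      (hasFDerivAt_iteratedLieDeriv hM hX hk (n + 1) hm)
      (hasFDerivAt_iteratedLieDeriv hM hX hk n hm) (X m)
    rw [one_mul] at this
    rw [← inner_conj_symm]
    refine (congrArg (starRingEnd ℂ) this).trans ?_
    rw [inner_conj_symm]
    rfl

lemma inner_iteratedLieDeriv_eigen {f : 𝓗} {z : ℂ}
    (h0 : ∀ m ∈ M, ⟪f, iteratedLieDeriv X k 1 m⟫_ℂ = z * ⟪f, k m⟫_ℂ) (n : ℕ) :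
    ∀ m ∈ M, ⟪f, iteratedLieDeriv X k (n + 1) m⟫_ℂ = z * ⟪f, iteratedLieDeriv X k n m⟫_ℂ := by
  induction n with
  | zero => exact h0
  | succ n ih =>
    intro m hm
    exact inner_fderiv_eq_of_inner_eq hM ih hm
      (hasFDerivAt_iteratedLieDeriv hM hX hk (n + 1) hm)
      (hasFDerivAt_iteratedLieDeriv hM hX hk n hm) (X m)

lemma hasDerivWithinAt_iteratedLieDeriv_comp {c : ℝ → E} {s : Set ℝ} {t : ℝ} (ht : c t ∈ M)
    (hc : HasDerivWithinAt c (X (c t)) s t) (n : ℕ) :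
    HasDerivWithinAt (fun t => iteratedLieDeriv X k n (c t)) (iteratedLieDeriv X k (n + 1) (c t))
      s t :=
  (hasFDerivAt_iteratedLieDeriv hM hX hk n ht).comp_hasDerivWithinAt t hc

/-- A vector acting as an eigenvector with nonreal eigenvalue on a symmetric flow is orthogonal to
every starting point of an integral curve. -/
theorem inner_eq_zero_of_integralCurve [CompleteSpace 𝓗]
    (hsymm : ∀ m ∈ M, ∀ p ∈ M,
      ⟪iteratedLieDeriv X k 1 m, k p⟫_ℂ = ⟪k m, iteratedLieDeriv X k 1 p⟫_ℂ)
    {f : 𝓗} {z : ℂ} (hz : z.im ≠ 0)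
    (hf : ∀ m ∈ M, ⟪f, iteratedLieDeriv X k 1 m⟫_ℂ = z * ⟪f, k m⟫_ℂ)
    {c : ℝ → E} {b : ℝ} (hb : 0 < b)
    (hc : ∀ t ∈ Set.Ico 0 b, c t ∈ M ∧ HasDerivWithinAt c (X (c t)) (Set.Ico 0 b) t) :
    ⟪f, k (c 0)⟫_ℂ = 0 := by
  have hderiv : ∀ n, ∀ t ∈ Set.Ioo 0 b, HasDerivAt (fun t => iteratedLieDeriv X k n (c t))
      (iteratedLieDeriv X k (n + 1) (c t)) t := by
    intro n t ht
    have hmem := Set.Ioo_subset_Ico_self ht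
    exact (hasDerivWithinAt_iteratedLieDeriv_comp hM hX hk (hc t hmem).1 (hc t hmem).2
      n).hasDerivAt (Ico_mem_nhds ht.1 ht.2)
  have hinterior : ∀ t ∈ Set.Ioo 0 b, ⟪f, k (c t)⟫_ℂ = 0 := by
    intro t ht
    obtain ⟨C, ρ, hρ, hx⟩ := exists_isAnalyticHankel_of_hasDerivAt hderiv
      (fun s hs n l => inner_iteratedLieDeriv_symm hM hX hk hsymm n l _
        (hc s (Set.Ioo_subset_Ico_self hs)).1 _ (hc s (Set.Ioo_subset_Ico_self hs)).1) ht
    exact hx.inner_eq_zero_of_eigen hρ hz fun n =>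
      inner_iteratedLieDeriv_eigen hM hX hk hf n _ (hc t (Set.Ioo_subset_Ico_self ht)).1
  have h0 : (0 : ℝ) ∈ Set.Ico 0 b := ⟨le_rfl, hb⟩
  have hcont : ContinuousWithinAt (fun t => ⟪f, k (c t)⟫_ℂ) (Set.Ioo 0 b) 0 :=
    continuousWithinAt_const.inner ((hasDerivWithinAt_iteratedLieDeriv_comp hM hX hk (hc 0 h0).1
      (hc 0 h0).2 0).continuousWithinAt.mono Set.Ioo_subset_Ico_self)
  have hne : (nhdsWithin (0 : ℝ) (Set.Ioo 0 b)).NeBot := left_nhdsWithin_Ioo_neBot hb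
  have hlim : Filter.Tendsto (fun t => ⟪f, k (c t)⟫_ℂ) (nhdsWithin 0 (Set.Ioo 0 b)) (nhds 0) :=
    tendsto_const_nhds.congr' (by
      filter_upwards [self_mem_nhdsWithin] with t ht using (hinterior t ht).symm)
  exact tendsto_nhds_unique hcont hlim

end LieDerivative

section Generator

variable {𝓗 : Type*} [NormedAddCommGroup 𝓗] [InnerProductSpace ℂ 𝓗]

/-- A symmetric assignment `k i ↦ v i` on a total family extends to a symmetric operator on the
linear span of the family. -/
theorem exists_linearPMap_of_symm {ι : Type*} {S : Set ι} {k v : ι → 𝓗}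
    (htotal : (Submodule.span ℂ (k '' S)).topologicalClosure = ⊤)
    (hsymm : ∀ m ∈ S, ∀ n ∈ S, ⟪v m, k n⟫_ℂ = ⟪k m, v n⟫_ℂ) :
    ∃ T : 𝓗 →ₗ.[ℂ] 𝓗, T.domain = Submodule.span ℂ (k '' S) ∧
      (∀ m ∈ S, ∀ h : k m ∈ T.domain, T ⟨k m, h⟩ = v m) ∧ T.IsFormalAdjoint T := by
  set G : Submodule ℂ (𝓗 × 𝓗) := Submodule.span ℂ ((fun m => (k m, v m)) '' S) with hG
  have hmap : G.map (LinearMap.fst ℂ 𝓗 𝓗) = Submodule.span ℂ (k '' S) := by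
    rw [hG, Submodule.map_span, Set.image_image]
    rfl
  have hGsymm : ∀ p ∈ G, ∀ q ∈ G, ⟪p.2, q.1⟫_ℂ = ⟪p.1, q.2⟫_ℂ := by
    intro p hp q hq
    induction hp, hq using Submodule.span_induction₂ with
    | mem_mem p q hp hq =>
      obtain ⟨m, hm, rfl⟩ := hp
      obtain ⟨n, hn, rfl⟩ := hq
      exact hsymm m hm n hn
    | zero_left => simp
    | zero_right => simp
    | add_left p p' q _ _ _ h h' => simp [h, h']
    | add_right p q q' _ _ _ h h' => simp [h, h']
    | smul_left c p q _ _ h => simp [h]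
    | smul_right c p q _ _ h => simp [h]
  have hgraph : ∀ p ∈ G, p.1 = 0 → p.2 = 0 := by
    intro p hp hp1
    refine (Submodule.dense_iff_topologicalClosure_eq_top.mpr htotal).eq_zero_of_inner_left ℂ
      fun u hu => ?_
    obtain ⟨q, hq, hqu⟩ : u ∈ G.map (LinearMap.fst ℂ 𝓗 𝓗) := hmap ▸ hu
    have := hGsymm p hp q hq
    rw [hp1, inner_zero_left] at this
    rw [← hqu]
    exact this
  have hT := G.toLinearPMap_graph_eq hgraph
  refine ⟨G.toLinearPMap, hmap, fun m hm h => ?_, fun u w => ?_⟩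
  · have hmem : (k m, v m) ∈ G.toLinearPMap.graph :=
      hT.symm ▸ Submodule.subset_span ⟨m, hm, rfl⟩
    exact (LinearPMap.mem_graph_snd_inj _ hmem (G.toLinearPMap.mem_graph ⟨k m, h⟩) rfl).symm
  · exact hGsymm _ (hT ▸ G.toLinearPMap.mem_graph u) _ (hT ▸ G.toLinearPMap.mem_graph w)

end Generator

/-- **Geometric Fröhlich Theorem (realization form).** Let `k : M → 𝓗` be a smooth map on an
open subset `M` of a real Banach space `E` with total image in the complex Hilbert space `𝓗`,
realizing the smooth positive definite kernel `K(m, n) = ⟪k n, k m⟫`. Let `X` be a smooth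
vector field on `M` admitting through every point `m ∈ M` an integral curve
`γ m : [0, ε m) → M` starting at `m`, and assume `K` is `X`-symmetric, i.e. for all
`m, n ∈ M` the right derivatives at `t = 0` of `t ↦ K(γ m t, n)` and `t ↦ K(m, γ n t)`
coincide. Then (a) the right derivative `v m` of `t ↦ k (γ m t)` at `0` exists for every
`m ∈ M` and there is a well-defined linear operator `T` on the span of `{k m : m ∈ M}`
with `T (k m) = v m`; (b) `T` is symmetric; (c) `T` is essentially self-adjoint:
its adjoint equals its closure, which is thus self-adjoint. -/
theorem geometric_frohlich
    {E : Type*} [NormedAddCommGroup E] [NormedSpace ℝ E] [CompleteSpace E]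
    {𝓗 : Type*} [NormedAddCommGroup 𝓗] [InnerProductSpace ℂ 𝓗] [CompleteSpace 𝓗]
    (M : Set E) (hM : IsOpen M)
    (k : E → 𝓗) (hk : ContDiffOn ℝ (⊤ : ℕ∞) k M)
    (htotal : Submodule.topologicalClosure (Submodule.span ℂ (k '' M)) = ⊤)
    (X : E → E) (hX : ContDiffOn ℝ (⊤ : ℕ∞) X M)
    (γ : E → ℝ → E) (ε : E → ℝ)
    (hcurve : ∀ m ∈ M, 0 < ε m ∧ γ m 0 = m ∧
      ∀ t ∈ Set.Ico (0 : ℝ) (ε m), γ m t ∈ M ∧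
        HasDerivWithinAt (γ m) (X (γ m t)) (Set.Ico 0 (ε m)) t)
    (hsym : ∀ m ∈ M, ∀ n ∈ M, ∃ a : ℂ,
      HasDerivWithinAt (fun t => ⟪k n, k (γ m t)⟫_ℂ) a (Set.Ici 0) 0 ∧
      HasDerivWithinAt (fun t => ⟪k (γ n t), k m⟫_ℂ) a (Set.Ici 0) 0) :
    ∃ T : 𝓗 →ₗ.[ℂ] 𝓗,
      T.domain = Submodule.span ℂ (k '' M) ∧
      (∀ m, ∀ _ : m ∈ M, ∀ h : k m ∈ T.domain,
        HasDerivWithinAt (fun t => k (γ m t)) (T ⟨k m, h⟩) (Set.Ici 0) 0) ∧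
      (∀ u w : T.domain, ⟪T u, (w : 𝓗)⟫_ℂ = ⟪(u : 𝓗), T w⟫_ℂ) ∧
      T.adjoint = T.closure := by
  have hcurve0 : ∀ m ∈ M, HasDerivWithinAt (fun t => k (γ m t)) (iteratedLieDeriv X k 1 m)
      (Set.Ici 0) 0 := by
    intro m hm
    obtain ⟨hε, h0, hγ⟩ := hcurve m hm
    obtain ⟨hmem, hd⟩ := hγ 0 ⟨le_rfl, hε⟩
    have h := hasDerivWithinAt_iteratedLieDeriv_comp hM hX hk hmem hd 0
    rw [h0] at h
    exact h.mono_of_mem_nhdsWithin (Ico_mem_nhdsGE hε)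
  have huniq := uniqueDiffWithinAt_Ici (0 : ℝ)
  have hsymm : ∀ m ∈ M, ∀ p ∈ M,
      ⟪iteratedLieDeriv X k 1 m, k p⟫_ℂ = ⟪k m, iteratedLieDeriv X k 1 p⟫_ℂ := by
    intro m hm p hp
    obtain ⟨a, ha, ha'⟩ := hsym p hp m hm
    have h1 := (hasDerivWithinAt_const (0 : ℝ) (Set.Ici 0) (k m)).inner ℂ (hcurve0 p hp)
    have h2 := (hcurve0 m hm).inner ℂ (hasDerivWithinAt_const (0 : ℝ) (Set.Ici 0) (k p))
    rw [inner_zero_left, add_zero] at h1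
    rw [inner_zero_right, zero_add] at h2
    rw [← huniq.eq_deriv _ ha h1, ← huniq.eq_deriv _ ha' h2]
  obtain ⟨T, hdom, hT, hTsymm⟩ := exists_linearPMap_of_symm htotal hsymm
  have hk_mem : ∀ m ∈ M, k m ∈ T.domain := fun m hm =>
    hdom ▸ Submodule.subset_span (Set.mem_image_of_mem k hm)
  have hdense : Dense (T.domain : Set 𝓗) := by
    rw [hdom]
    exact Submodule.dense_iff_topologicalClosure_eq_top.mpr htotal
  refine ⟨T, hdom, fun m hm h => ?_, hTsymm, ?_⟩
  · rw [hT m hm h]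
    exact hcurve0 m hm
  · refine LinearPMap.adjoint_eq_closure_of_deficiency hdense hTsymm fun z hz f hf => ?_
    have hzim : z.im ≠ 0 := by rcases hz with rfl | rfl <;> simp
    have hfk : ∀ m ∈ M, ⟪f, iteratedLieDeriv X k 1 m⟫_ℂ = z * ⟪f, k m⟫_ℂ := fun m hm => by
      rw [← hT m hm (hk_mem m hm)]
      exact hf ⟨k m, hk_mem m hm⟩
    have horth : ∀ m ∈ M, ⟪f, k m⟫_ℂ = 0 := fun m hm => by
      obtain ⟨hε, h0, hγ⟩ := hcurve m hm
      rw [← h0]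
      exact inner_eq_zero_of_integralCurve hM hX hk hsymm hzim hfk hε hγ
    refine hdense.eq_zero_of_inner_left ℂ fun u hu => ?_
    replace hu : u ∈ Submodule.span ℂ (k '' M) := hdom ▸ hu
    induction hu using Submodule.span_induction with
    | mem x hx =>
      obtain ⟨m, hm, rfl⟩ := hx
      exact horth m hm
    | zero => simp
    | add x y _ _ hx hy => rw [inner_add_right, hx, hy, add_zero]
    | smul c x _ hx => rw [inner_smul_right, hx, mul_zero]
end

section
/- (Linear Fröhlich corollary, realization form.) Let V be a complex vector space, 𝓗 a complex Hilbert space, and j : V → 𝓗 a linear map with dense range. Let L : V → V be a linear map that is symmetric with respect to the induced form, i.e. ⟪j(L v), j(w)⟫ = ⟪j(v), j(L w)⟫ for all v, w ∈ V. Assume that for every v ∈ V there exist ε_v > 0 and a curve γ_v : [0, ε_v) → V with γ_v(0) = v such that the curve t ↦ j(γ_v(t)) in 𝓗 is differentiable on [0, ε_v) with derivative j(L(γ_v(t))) at every t. Then the linear operator A on j(V) determined by A(j(v)) := j(L(v)) is well defined (j(v) = j(v') implies j(L v) = j(L v')), symmetric with respect to the inner product of 𝓗, and essentially self-adjoint: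 its closure is a self-adjoint operator in 𝓗. -/
open scoped InnerProductSpace
open scoped Nat

section HankelSequences

variable {𝓗 : Type*} [NormedAddCommGroup 𝓗] [InnerProductSpace ℂ 𝓗]

/-- The exponential series `∑ zᵐ / m! • x (m + k)`; for `x k = Aᵏ φ` this is `Aᵏ exp (z A) φ`. -/
noncomputable def expShift (z : ℂ) (x : ℕ → 𝓗) (k : ℕ) : 𝓗 :=
  ∑' m : ℕ, (z ^ m / (m ! : ℂ)) • x (m + k)

lemma factorial_add_le (m k : ℕ) : (m + k)! ≤ 2 ^ (m + k) * (m ! * k !) := by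
  rw [← Nat.add_choose_mul_factorial_mul_factorial m k, mul_assoc]
  exact Nat.mul_le_mul_right _ (Nat.choose_le_two_pow _ _)

lemma summable_norm_expShift {x : ℕ → 𝓗} {C R : ℝ} (hR : 0 < R)
    (hx : ∀ k, ‖x k‖ ≤ C * R ^ k * (k ! : ℝ)) {z : ℂ} (hz : ‖z‖ * (2 * R) < 1) (k : ℕ) :
    Summable fun m : ℕ => ‖(z ^ m / (m ! : ℂ)) • x (m + k)‖ := by
  have hC : 0 ≤ C := by simpa using (norm_nonneg _).trans (hx 0)
  refine Summable.of_nonneg_of_le (fun _ => norm_nonneg _) (fun m => ?_)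
    ((summable_geometric_of_lt_one (by positivity) hz).mul_left (C * (2 * R) ^ k * (k ! : ℝ)))
  rw [norm_smul, norm_div, norm_pow, Complex.norm_natCast]
  have h1 : ((m + k)! : ℝ) ≤ 2 ^ (m + k) * ((m ! : ℝ) * (k ! : ℝ)) := by
    exact_mod_cast factorial_add_le m k
  have hm : (0 : ℝ) < (m ! : ℝ) := by positivity
  calc ‖z‖ ^ m / (m ! : ℝ) * ‖x (m + k)‖
      ≤ ‖z‖ ^ m / (m ! : ℝ) * (C * R ^ (m + k) * (2 ^ (m + k) * ((m ! : ℝ) * (k ! : ℝ)))) := by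
        gcongr
        exact (hx _).trans (by gcongr)
    _ = C * (2 * R) ^ k * (k ! : ℝ) * (‖z‖ * (2 * R)) ^ m := by
        field_simp
        ring

lemma hasSum_inner {ι κ : Type*} {f : ι → 𝓗} {g : κ → 𝓗} {a b : 𝓗}
    (hf : HasSum f a) (hg : HasSum g b)
    (hfn : Summable fun i => ‖f i‖) (hgn : Summable fun i => ‖g i‖) :
    HasSum (fun p : ι × κ => ⟪f p.1, g p.2⟫_ℂ) ⟪a, b⟫_ℂ := by
  have hs : Summable fun p : ι × κ => ⟪f p.1, g p.2⟫_ℂ := by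
    refine Summable.of_norm_bounded (hfn.mul_of_nonneg hgn (fun _ => norm_nonneg _)
      (fun _ => norm_nonneg _)) fun p => norm_inner_le_norm _ _
  have h1 : ∀ i, HasSum (fun k => ⟪f i, g k⟫_ℂ) ⟪f i, b⟫_ℂ := fun i =>
    hg.mapL (innerSL ℂ (f i))
  have h2 : HasSum (fun i => ⟪f i, b⟫_ℂ) ⟪a, b⟫_ℂ := by
    have := (hf.mapL (innerSL ℂ b)).star
    simpa using this
  have h3 := hs.hasSum.prod_fiberwise h1
  rw [h2.unique h3]
  exact hs.hasSum

lemma inner_hankel {x : ℕ → 𝓗} (hx : ∀ k l, ⟪x (k + 1), x l⟫_ℂ = ⟪x k, x (l + 1)⟫_ℂ)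
    (k l : ℕ) : ⟪x k, x l⟫_ℂ = ⟪x 0, x (k + l)⟫_ℂ := by
  induction k generalizing l with
  | zero => simp
  | succ k ih => rw [hx, ih]; congr 2; ring

lemma sum_antidiagonal_pow_div_factorial (z w : ℂ) (n : ℕ) :
    ∑ p ∈ Finset.HasAntidiagonal.antidiagonal n, z ^ p.1 / (p.1 ! : ℂ) * (w ^ p.2 / (p.2 ! : ℂ)) =
      (z + w) ^ n / (n ! : ℂ) := by
  rw [(Commute.all z w).add_pow', Finset.sum_div]
  refine Finset.sum_congr rfl fun p hp => ?_
  rw [← Finset.HasAntidiagonal.mem_antidiagonal.1 hp, nsmul_eq_mul]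
  have h : ((p.1 + p.2).choose p.1 : ℂ) * (p.1 ! : ℂ) * (p.2 ! : ℂ) = ((p.1 + p.2)! : ℂ) := by
    rw [Nat.choose_symm_add]
    exact_mod_cast Nat.add_choose_mul_factorial_mul_factorial p.1 p.2
  have h1 : (p.1 ! : ℂ) ≠ 0 := by exact_mod_cast Nat.factorial_ne_zero _
  have h2 : (p.2 ! : ℂ) ≠ 0 := by exact_mod_cast Nat.factorial_ne_zero _
  have h3 : ((p.1 + p.2)! : ℂ) ≠ 0 := by exact_mod_cast Nat.factorial_ne_zero _
  field_simp
  rw [← h]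
  ring

variable [CompleteSpace 𝓗]

lemma hasSum_expShift {x : ℕ → 𝓗} {z : ℂ}
    (hs : ∀ k, Summable fun m : ℕ => ‖(z ^ m / (m ! : ℂ)) • x (m + k)‖) (k : ℕ) :
    HasSum (fun m : ℕ => (z ^ m / (m ! : ℂ)) • x (m + k)) (expShift z x k) :=
  (hs k).of_norm.hasSum

lemma inner_expShift_succ {x : ℕ → 𝓗} (hx : ∀ k l, ⟪x (k + 1), x l⟫_ℂ = ⟪x k, x (l + 1)⟫_ℂ)
    {z : ℂ} (hs : ∀ k, Summable fun m : ℕ => ‖(z ^ m / (m ! : ℂ)) • x (m + k)‖) (k l : ℕ) :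
    ⟪expShift z x (k + 1), expShift z x l⟫_ℂ = ⟪expShift z x k, expShift z x (l + 1)⟫_ℂ := by
  have h := fun k l => hasSum_inner (hasSum_expShift hs k) (hasSum_expShift hs l) (hs k) (hs l)
  refine (h (k + 1) l).unique ((h k (l + 1)).congr_fun ?_)
  rintro ⟨m, n⟩
  simp only [inner_smul_left, inner_smul_right, ← add_assoc, hx]

lemma norm_expShift {x : ℕ → 𝓗} (hx : ∀ k l, ⟪x (k + 1), x l⟫_ℂ = ⟪x k, x (l + 1)⟫_ℂ)
    {z : ℂ} (hz : (starRingEnd ℂ) z = -z)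
    (hs : ∀ k, Summable fun m : ℕ => ‖(z ^ m / (m ! : ℂ)) • x (m + k)‖) (k : ℕ) :
    ‖expShift z x k‖ = ‖x k‖ := by
  have h := hasSum_inner (hasSum_expShift hs k) (hasSum_expShift hs k) (hs k) (hs k)
  have h1 : HasSum (fun n : ℕ => ((-z + z) ^ n / (n ! : ℂ)) * ⟪x 0, x (n + (k + k))⟫_ℂ)
      ⟪expShift z x k, expShift z x k⟫_ℂ := by
    rw [← Finset.HasAntidiagonal.sigmaAntidiagonalEquivProd.hasSum_iff] at h
    have h' := h.sigma fun n => hasSum_fintype _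
    refine h'.congr_fun fun n => ?_
    rw [← sum_antidiagonal_pow_div_factorial, Finset.sum_mul, ← Finset.sum_coe_sort]
    refine Finset.sum_congr rfl fun p _ => ?_
    obtain ⟨⟨a, b⟩, hp⟩ := p
    have hp' : a + b = n := Finset.HasAntidiagonal.mem_antidiagonal.1 hp
    simp only [Function.comp, Finset.HasAntidiagonal.sigmaAntidiagonalEquivProd_apply,
      inner_smul_left, inner_smul_right, map_div₀, map_pow, hz, map_natCast]
    rw [inner_hankel hx (a + k), ← hp']
    have : a + k + (b + k) = a + b + (k + k) := by ring
    rw [this]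
    ring
  have h2 := hasSum_single (f := fun n : ℕ => ((-z + z) ^ n / (n ! : ℂ)) *
    ⟪x 0, x (n + (k + k))⟫_ℂ) 0 (fun n hn => by simp [hn])
  have h3 := h1.unique h2
  simp only [pow_zero, Nat.factorial_zero, Nat.cast_one, div_one, one_mul, zero_add] at h3
  rw [← inner_hankel hx, inner_self_eq_norm_sq_to_K, inner_self_eq_norm_sq_to_K] at h3
  have h4 : ‖expShift z x k‖ ^ 2 = ‖x k‖ ^ 2 := by exact_mod_cast h3
  exact (pow_left_inj₀ (norm_nonneg _) (norm_nonneg _) two_ne_zero).1 h4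

lemma inner_expShift {x : ℕ → 𝓗} {ψ : 𝓗} {c z : ℂ}
    (hψ : ∀ k, ⟪ψ, x (k + 1)⟫_ℂ = c * ⟪ψ, x k⟫_ℂ)
    (hs : ∀ k, Summable fun m : ℕ => ‖(z ^ m / (m ! : ℂ)) • x (m + k)‖) (k : ℕ) :
    ⟪ψ, expShift z x k⟫_ℂ = Complex.exp (z * c) * ⟪ψ, x k⟫_ℂ := by
  have hk : ∀ m, ⟪ψ, x (m + k)⟫_ℂ = c ^ m * ⟪ψ, x k⟫_ℂ := by
    intro m
    induction m with
    | zero => simp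
    | succ m ih => rw [show m + 1 + k = m + k + 1 by ring, hψ, ih]; ring
  have h1 := (hasSum_expShift hs k).mapL (innerSL ℂ ψ)
  have h2 : HasSum (fun m : ℕ => (z * c) ^ m / (m ! : ℂ)) (Complex.exp (z * c)) := by
    rw [Complex.exp_eq_exp_ℂ]
    exact NormedSpace.expSeries_div_hasSum_exp (z * c)
  refine h1.unique ((h2.mul_right ⟪ψ, x k⟫_ℂ).congr_fun fun m => ?_)
  simp only [innerSL_apply_apply, inner_smul_right, hk]
  ring

/-- A deficiency vector is orthogonal to every analytic vector. -/
theorem inner_eq_zero_of_analytic {x : ℕ → 𝓗} {C R : ℝ} (hR : 0 < R)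
    (hxn : ∀ k, ‖x k‖ ≤ C * R ^ k * (k ! : ℝ))
    (hx : ∀ k l, ⟪x (k + 1), x l⟫_ℂ = ⟪x k, x (l + 1)⟫_ℂ)
    {ψ : 𝓗} {c : ℂ} (hc : c * c = -1) (hc' : (starRingEnd ℂ) c = -c)
    (hψ : ∀ k, ⟪ψ, x (k + 1)⟫_ℂ = c * ⟪ψ, x k⟫_ℂ) :
    ⟪ψ, x 0⟫_ℂ = 0 := by
  set σ : ℝ := 1 / (4 * R) with hσ
  have hσ0 : 0 < σ := by positivity
  set z : ℂ := -(σ * c) with hzdef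
  have hcn : ‖c‖ = 1 := by
    have h : ‖c‖ * ‖c‖ = 1 := by rw [← norm_mul, hc]; simp
    nlinarith [norm_nonneg c]
  have hzc : z * c = (σ : ℂ) := by
    rw [hzdef, neg_mul, mul_assoc, hc]; ring
  have hzconj : (starRingEnd ℂ) z = -z := by
    simp [hzdef, hc']
  have hzn : ‖z‖ * (2 * R) < 1 := by
    rw [hzdef, norm_neg, norm_mul, hcn, Complex.norm_real, Real.norm_of_nonneg hσ0.le, hσ]
    field_simp
    norm_num
  have key : ∀ N : ℕ, ∀ y : ℕ → 𝓗, (∀ k, ‖y k‖ ≤ C * R ^ k * (k ! : ℝ)) →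
      (∀ k l, ⟪y (k + 1), y l⟫_ℂ = ⟪y k, y (l + 1)⟫_ℂ) →
      (∀ k, ⟪ψ, y (k + 1)⟫_ℂ = c * ⟪ψ, y k⟫_ℂ) →
      Real.exp σ ^ N * ‖⟪ψ, y 0⟫_ℂ‖ ≤ ‖ψ‖ * ‖y 0‖ := by
    intro N
    induction N with
    | zero => intro y _ _ _; simpa using norm_inner_le_norm ψ (y 0)
    | succ N ih =>
      intro y h1 h2 h3
      have hs := summable_norm_expShift hR h1 hzn
      have hn := norm_expShift h2 hzconj hs
      have hi := inner_expShift h3 hs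
      have := ih (expShift z y) (fun k => (hn k).trans_le (h1 k)) (inner_expShift_succ h2 hs)
        (fun k => by rw [hi, hi, h3]; ring)
      rw [hi, hn, hzc, norm_mul, Complex.norm_exp, Complex.ofReal_re] at this
      rwa [pow_succ, mul_assoc]
  by_contra hne
  have hpos : 0 < ‖⟪ψ, x 0⟫_ℂ‖ := norm_pos_iff.2 hne
  obtain ⟨N, hN⟩ := pow_unbounded_of_one_lt (‖ψ‖ * ‖x 0‖ / ‖⟪ψ, x 0⟫_ℂ‖)
    (Real.one_lt_exp_iff.2 hσ0)
  rw [div_lt_iff₀ hpos] at hN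
  exact absurd (key N x hxn hx hψ) (not_le.2 hN)

end HankelSequences

section AbsolutelyMonotone

lemma le_of_hasDerivAt_nonneg_Ico {f f' : ℝ → ℝ} {h s : ℝ}
    (hf : ∀ s ∈ Set.Ico 0 h, HasDerivAt f (f' s) s) (hf' : ∀ s ∈ Set.Ico 0 h, 0 ≤ f' s)
    (hs : s ∈ Set.Ico 0 h) : f 0 ≤ f s := by
  refine monotoneOn_of_hasDerivWithinAt_nonneg (convex_Ico 0 h)
    (fun t ht => (hf t ht).continuousAt.continuousWithinAt)
    (fun t ht => (hf t (interior_subset ht)).hasDerivWithinAt)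
    (fun t ht => hf' t (interior_subset ht)) ⟨le_rfl, hs.1.trans_lt hs.2⟩ hs hs.1

/-- The values of an absolutely monotone function dominate the terms of its Taylor series. -/
lemma absolutelyMonotone_taylor_term_le {d : ℕ → ℝ → ℝ} {h : ℝ}
    (hd : ∀ n, ∀ s ∈ Set.Ico 0 h, HasDerivAt (d n) (d (n + 1) s) s)
    (hd0 : ∀ n, ∀ s ∈ Set.Ico 0 h, 0 ≤ d n s) (m n : ℕ) {s : ℝ} (hs : s ∈ Set.Ico 0 h) :
    d (n + m) 0 * (s ^ m / (m ! : ℝ)) ≤ d n s := by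
  induction m generalizing n s with
  | zero => simpa using le_of_hasDerivAt_nonneg_Ico (hd n) (hd0 (n + 1)) hs
  | succ m ih =>
    have h1 : ∀ t : ℝ, HasDerivAt (fun s : ℝ => d (n + (m + 1)) 0 * (s ^ (m + 1) / ((m + 1)! : ℝ)))
        (d (n + 1 + m) 0 * (t ^ m / (m ! : ℝ))) t := by
      intro t
      refine (((hasDerivAt_pow (m + 1) t).div_const ((m + 1)! : ℝ)).const_mul
        (d (n + (m + 1)) 0)).congr_deriv ?_
      rw [show n + 1 + m = n + (m + 1) by ring, Nat.factorial_succ]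
      push_cast
      field_simp
    have h2 := le_of_hasDerivAt_nonneg_Ico (fun t ht => (hd n t ht).sub (h1 t))
      (fun t ht => sub_nonneg.2 (ih (n + 1) ht)) hs
    have h3 := hd0 n 0 ⟨le_rfl, hs.1.trans_lt hs.2⟩
    simp only [Pi.sub_apply, ne_eq, Nat.succ_ne_zero, not_false_eq_true, zero_pow, zero_div,
      mul_zero, sub_zero] at h2
    linarith

/-- Bernstein's estimate: if all even derivatives are nonnegative, they grow at most like those of
an analytic function. -/
lemma even_deriv_bound {g : ℕ → ℝ → ℝ} {τ h s : ℝ}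
    (hg : ∀ n, ∀ t ∈ Set.Ioo (τ - h) (τ + h), HasDerivAt (g n) (g (n + 1) t) t)
    (hg0 : ∀ k, ∀ t ∈ Set.Ioo (τ - h) (τ + h), 0 ≤ g (2 * k) t)
    (hs : s ∈ Set.Ico 0 h) (k : ℕ) :
    2 * g (2 * k) τ * (s ^ (2 * k) / ((2 * k)! : ℝ)) ≤ g 0 (τ + s) + g 0 (τ - s) := by
  set d : ℕ → ℝ → ℝ := fun n t => g n (τ + t) + (-1) ^ n * g n (τ - t) with hd
  have hder : ∀ n, ∀ t ∈ Set.Ico 0 h, HasDerivAt (d n) (d (n + 1) t) t := by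
    intro n t ht
    have h1 := (hg n (τ + t) ⟨by linarith [ht.1, ht.2], by linarith [ht.2]⟩).comp_const_add τ t
    have h2 := (hg n (τ - t) ⟨by linarith [ht.2], by linarith [ht.1, ht.2]⟩).comp_const_sub τ t
    refine (h1.add (h2.const_mul ((-1) ^ n))).congr_deriv ?_
    simp only [hd]
    ring
  have heven : ∀ k, ∀ t ∈ Set.Ico 0 h, 0 ≤ d (2 * k) t := by
    intro k t ht
    have h1 := hg0 k (τ + t) ⟨by linarith [ht.1, ht.2], by linarith [ht.2]⟩
    have h2 := hg0 k (τ - t) ⟨by linarith [ht.2], by linarith [ht.1, ht.2]⟩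
    simp only [hd, pow_mul, even_two, Even.neg_pow, one_pow, one_mul]
    linarith
  have hnonneg : ∀ n, ∀ t ∈ Set.Ico 0 h, 0 ≤ d n t := by
    intro n t ht
    obtain ⟨k, rfl | rfl⟩ := n.even_or_odd'
    · exact heven k t ht
    · have h1 := le_of_hasDerivAt_nonneg_Ico (hder (2 * k + 1))
        (by simpa only [show 2 * k + 1 + 1 = 2 * (k + 1) by ring] using heven (k + 1)) ht
      have h2 : d (2 * k + 1) 0 = 0 := by simp [hd, pow_succ, pow_mul]
      rwa [h2] at h1
  have := absolutelyMonotone_taylor_term_le hder hnonneg (2 * k) 0 hs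
  simp only [hd, zero_add, add_zero, sub_zero, pow_zero, one_mul, pow_mul, even_two, Even.neg_pow,
    one_pow] at this
  rw [← pow_mul] at this
  linarith

end AbsolutelyMonotone

lemma factorial_two_mul_le_sq (k : ℕ) : (2 * k)! ≤ (2 ^ k * k !) ^ 2 := by
  induction k with
  | zero => simp
  | succ k ih =>
    have h : (2 * (k + 1))! = (2 * k + 2) * (2 * k + 1) * (2 * k)! := by
      rw [show 2 * (k + 1) = 2 * k + 1 + 1 by ring, Nat.factorial_succ, Nat.factorial_succ]
      ring
    calc (2 * (k + 1))! = (2 * k + 2) * (2 * k + 1) * (2 * k)! := h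
      _ ≤ (2 * k + 2) * (2 * k + 2) * (2 ^ k * k !) ^ 2 := by gcongr; omega
      _ = (2 ^ (k + 1) * (k + 1)!) ^ 2 := by rw [Nat.factorial_succ]; ring

section Flow

variable {V : Type*} [AddCommGroup V] [Module ℂ V]
  {𝓗 : Type*} [NormedAddCommGroup 𝓗] [InnerProductSpace ℂ 𝓗]
  {j : V →ₗ[ℂ] 𝓗} {L : V →ₗ[ℂ] V}

lemma inner_pow_symm (hsym : ∀ v w : V, ⟪j (L v), j w⟫_ℂ = ⟪j v, j (L w)⟫_ℂ) (n : ℕ) (v w : V) :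
    ⟪j ((L ^ n) v), j w⟫_ℂ = ⟪j v, j ((L ^ n) w)⟫_ℂ := by
  induction n generalizing v w with
  | zero => simp
  | succ n ih => rw [pow_succ, Module.End.mul_apply, ih, hsym, ← Module.End.mul_apply, ← pow_succ',
    pow_succ]

variable {γ : ℝ → V} {ε : ℝ}

/-- Along a flow line of a symmetric operator the Gram kernel is a Hankel kernel. -/
lemma inner_flow (hsym : ∀ v w : V, ⟪j (L v), j w⟫_ℂ = ⟪j v, j (L w)⟫_ℂ)
    (hγ : ∀ t ∈ Set.Ico (0 : ℝ) ε,
      HasDerivWithinAt (fun s => j (γ s)) (j (L (γ t))) (Set.Ico 0 ε) t)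
    {a b : ℝ} (ha : 0 ≤ a) (hb : 0 ≤ b) (hab : a + b < ε) :
    ⟪j (γ a), j (γ b)⟫_ℂ = ⟪j (γ 0), j (γ (a + b))⟫_ℂ := by
  have hsub : Set.Icc 0 (a + b) ⊆ Set.Ico 0 ε := fun t ht => ⟨ht.1, ht.2.trans_lt hab⟩
  have hd : ∀ t ∈ Set.Icc 0 (a + b), HasDerivWithinAt
      (fun s => ⟪j (γ s), j (γ (a + b - s))⟫_ℂ) 0 (Set.Icc 0 (a + b)) t := by
    intro t ht
    have ht' : a + b - t ∈ Set.Icc 0 (a + b) := ⟨by linarith [ht.2], by linarith [ht.1]⟩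
    have h1 := (hγ t (hsub ht)).mono hsub
    have h2 := ((hγ _ (hsub ht')).mono hsub).scomp t
      ((hasDerivAt_id t).const_sub (a + b)).hasDerivWithinAt
      (fun s (hs : s ∈ Set.Icc 0 (a + b)) => (⟨by simpa using hs.2, by simpa using hs.1⟩ :
        a + b - s ∈ Set.Icc 0 (a + b)))
    have h3 := h1.inner ℂ h2
    refine h3.congr_deriv ?_
    simp [hsym]
  have := constant_of_derivWithin_zero (fun t ht => (hd t ht).differentiableWithinAt)
    (fun t ht => by
      have hlt : (0 : ℝ) < a + b := ht.1.trans_lt ht.2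
      exact (hd t ⟨ht.1, ht.2.le⟩).derivWithin (uniqueDiffOn_Icc hlt t ⟨ht.1, ht.2.le⟩))
    a ⟨ha, by linarith⟩
  simpa using this

lemma inner_flow_pow (hsym : ∀ v w : V, ⟪j (L v), j w⟫_ℂ = ⟪j v, j (L w)⟫_ℂ)
    (hγ : ∀ t ∈ Set.Ico (0 : ℝ) ε,
      HasDerivWithinAt (fun s => j (γ s)) (j (L (γ t))) (Set.Ico 0 ε) t)
    (n : ℕ) {a b : ℝ} (ha : 0 ≤ a) (hb : 0 ≤ b) (hab : a + b < ε) :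
    ⟪j (γ a), j ((L ^ n) (γ b))⟫_ℂ = ⟪j ((L ^ n) (γ 0)), j (γ (a + b))⟫_ℂ := by
  induction n generalizing a with
  | zero => simpa using inner_flow hsym hγ ha hb hab
  | succ n ih =>
    have ha' : a ∈ Set.Ico 0 (ε - b) := ⟨ha, by linarith⟩
    have hsub : Set.Ico 0 (ε - b) ⊆ Set.Ico 0 ε := fun t ht => ⟨ht.1, by linarith [ht.2]⟩
    have h1 := ((hγ a (hsub ha')).mono hsub).inner ℂ
      (hasDerivWithinAt_const a (Set.Ico 0 (ε - b)) (j ((L ^ n) (γ b))))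
    have h2 := (hγ (a + b) ⟨by linarith, hab⟩).scomp a
      (((hasDerivAt_id a).add_const b).hasDerivWithinAt (s := Set.Ico 0 (ε - b)))
      (fun s hs => (⟨by simpa using add_nonneg hs.1 hb, by have := hs.2; simp; linarith⟩ :
        id s + b ∈ Set.Ico 0 ε))
    have h3 := (hasDerivWithinAt_const a (Set.Ico 0 (ε - b)) (j ((L ^ n) (γ 0)))).inner ℂ h2
    have h4 := h1.congr (f₁ := fun s => ⟪j ((L ^ n) (γ 0)), j (γ (s + b))⟫_ℂ)
      (fun s hs => (ih hs.1 (by linarith [hs.2])).symm) (ih ha hab).symm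
    have h5 := (uniqueDiffOn_Ico 0 (ε - b) a ha').eq_deriv _ h4 h3
    simp only [inner_zero_right, inner_zero_left, zero_add, add_zero, one_smul, id] at h5
    rw [pow_succ', Module.End.mul_apply, Module.End.mul_apply, hsym, ← hsym, h5]

/-- Interior points of a flow line of a symmetric operator are analytic vectors. -/
lemma exists_analytic_bound (hsym : ∀ v w : V, ⟪j (L v), j w⟫_ℂ = ⟪j v, j (L w)⟫_ℂ)
    (hγ : ∀ t ∈ Set.Ico (0 : ℝ) ε,
      HasDerivWithinAt (fun s => j (γ s)) (j (L (γ t))) (Set.Ico 0 ε) t)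
    {t : ℝ} (ht : 0 < t) (htε : 2 * t < ε) :
    ∃ C R : ℝ, 0 < R ∧ ∀ k, ‖j ((L ^ k) (γ t))‖ ≤ C * R ^ k * (k ! : ℝ) := by
  set g : ℕ → ℝ → ℝ := fun n τ => (⟪j ((L ^ n) (γ 0)), j (γ τ)⟫_ℂ).re with hgdef
  have hg : ∀ n, ∀ τ ∈ Set.Ioo 0 ε, HasDerivAt (g n) (g (n + 1) τ) τ := by
    intro n τ hτ
    have h1 := (hγ τ ⟨hτ.1.le, hτ.2⟩).hasDerivAt (Ico_mem_nhds hτ.1 hτ.2)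
    have h2 := (hasDerivAt_const τ (j ((L ^ n) (γ 0)))).inner ℂ h1
    refine (Complex.reCLM.hasFDerivAt.comp_hasDerivAt τ h2).congr_deriv ?_
    simp [hgdef, pow_succ', hsym]
  have hsq : ∀ k, ∀ τ ∈ Set.Ioo 0 ε, g (2 * k) τ = ‖j ((L ^ k) (γ (τ / 2)))‖ ^ 2 := by
    intro k τ hτ
    have h1 := inner_flow_pow hsym hγ (2 * k) (a := τ / 2) (b := τ / 2) (by linarith [hτ.1])
      (by linarith [hτ.1]) (by linarith [hτ.2])
    rw [add_halves, two_mul, pow_add, Module.End.mul_apply, ← inner_pow_symm hsym] at h1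
    simp only [hgdef]
    rw [two_mul, pow_add, ← h1, inner_self_eq_norm_sq_to_K]
    norm_cast
  obtain ⟨h, hh0, hh1, hh2⟩ : ∃ h : ℝ, 0 < h ∧ h < 2 * t ∧ 2 * t + h < ε := by
    obtain ⟨h, h0, h1⟩ := exists_between (show 0 < min (2 * t) (ε - 2 * t) from
      lt_min (by linarith) (by linarith))
    exact ⟨h, h0, h1.trans_le (min_le_left _ _),
      by linarith [h1.trans_le (min_le_right (2 * t) (ε - 2 * t))]⟩
  have hsub : Set.Ioo (2 * t - h) (2 * t + h) ⊆ Set.Ioo 0 ε := fun τ hτ =>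
    ⟨by linarith [hτ.1], by linarith [hτ.2]⟩
  obtain ⟨s, hs0, hsh⟩ := exists_between hh0
  have key := even_deriv_bound (fun n τ hτ => hg n τ (hsub hτ))
    (fun k τ hτ => by rw [hsq k τ (hsub hτ)]; positivity)
    (show s ∈ Set.Ico 0 h from ⟨hs0.le, hsh⟩)
  set M := g 0 (2 * t + s) + g 0 (2 * t - s) with hM
  refine ⟨√M, 2 / s, by positivity, fun k => ?_⟩
  have hk := key k
  rw [hsq k _ ⟨by linarith, by linarith⟩, mul_div_cancel_left₀ _ two_ne_zero] at hk
  have hM0 : 0 ≤ M := le_trans (by positivity) hk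
  have hfac : ((2 * k)! : ℝ) ≤ (2 ^ k * (k ! : ℝ)) ^ 2 := by
    exact_mod_cast factorial_two_mul_le_sq k
  refine le_of_sq_le_sq ?_ (by positivity)
  rw [← mul_div_assoc, div_le_iff₀ (by positivity)] at hk
  have h1 : ‖j ((L ^ k) (γ t))‖ ^ 2 * s ^ (2 * k) ≤ M * (2 ^ k * (k ! : ℝ)) ^ 2 := by
    have h2 : 0 ≤ ‖j ((L ^ k) (γ t))‖ ^ 2 * s ^ (2 * k) := by positivity
    nlinarith [mul_le_mul_of_nonneg_left hfac hM0]
  calc ‖j ((L ^ k) (γ t))‖ ^ 2 ≤ M * (2 ^ k * (k ! : ℝ)) ^ 2 / s ^ (2 * k) :=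
        (le_div_iff₀ (by positivity)).2 h1
    _ = (√M * (2 / s) ^ k * (k ! : ℝ)) ^ 2 := by
        rw [mul_pow (√M * _), mul_pow √M, Real.sq_sqrt hM0, div_pow]
        field_simp
        ring

variable [CompleteSpace 𝓗]

lemma eq_zero_of_deficiency (hdense : Dense (Set.range j))
    (hsym : ∀ v w : V, ⟪j (L v), j w⟫_ℂ = ⟪j v, j (L w)⟫_ℂ)
    (hflow : ∀ v : V, ∃ ε > (0 : ℝ), ∃ γ : ℝ → V, γ 0 = v ∧
      ∀ t ∈ Set.Ico (0 : ℝ) ε,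
        HasDerivWithinAt (fun s => j (γ s)) (j (L (γ t))) (Set.Ico 0 ε) t)
    {ψ : 𝓗} {c : ℂ} (hc : c * c = -1) (hc' : (starRingEnd ℂ) c = -c)
    (hψ : ∀ v, ⟪ψ, j (L v)⟫_ℂ = c * ⟪ψ, j v⟫_ℂ) : ψ = 0 := by
  refine hdense.eq_zero_of_inner_left ℂ ?_
  rintro _ ⟨v, rfl⟩
  obtain ⟨ε, hε, γ, rfl, hγ⟩ := hflow v
  have hzero : ∀ t ∈ Set.Ioo 0 (ε / 2), ⟪ψ, j (γ t)⟫_ℂ = 0 := by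
    intro t ht
    obtain ⟨C, R, hR, hb⟩ := exists_analytic_bound hsym hγ ht.1 (by linarith [ht.2])
    have := inner_eq_zero_of_analytic (ψ := ψ) (x := fun k => j ((L ^ k) (γ t))) hR hb
      (fun k l => by simp only [pow_succ', Module.End.mul_apply, hsym]) hc hc'
      (fun k => by simp only [pow_succ', Module.End.mul_apply, hψ])
    simpa using this
  have hcont : Filter.Tendsto (fun t => ⟪ψ, j (γ t)⟫_ℂ) (nhdsWithin 0 (Set.Ioo 0 (ε / 2)))
      (nhds ⟪ψ, j (γ 0)⟫_ℂ) :=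
    tendsto_const_nhds.inner ((hγ 0 ⟨le_rfl, hε⟩).continuousWithinAt.mono
      fun t ht => ⟨ht.1.le, by linarith [ht.2]⟩)
  have : (nhdsWithin (0 : ℝ) (Set.Ioo 0 (ε / 2))).NeBot :=
    left_nhdsWithin_Ioo_neBot (by positivity)
  refine tendsto_nhds_unique hcont (tendsto_const_nhds.congr' ?_)
  filter_upwards [self_mem_nhdsWithin] with t ht using (hzero t ht).symm

end Flow

/-- The basic criterion for essential self-adjointness. -/
theorem LinearPMap.adjoint_eq_closure_of_deficiency_eq_zero
    {𝓗 : Type*} [NormedAddCommGroup 𝓗] [InnerProductSpace ℂ 𝓗] [CompleteSpace 𝓗]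
    {A : 𝓗 →ₗ.[ℂ] 𝓗} (hA : Dense (A.domain : Set 𝓗)) (hsym : A.IsFormalAdjoint A)
    (hdef : ∀ c : ℂ, c * c = -1 → (starRingEnd ℂ) c = -c → ∀ ψ : 𝓗,
      (∀ u : A.domain, ⟪ψ, A u⟫_ℂ = c * ⟪ψ, (u : 𝓗)⟫_ℂ) → ψ = 0) :
    A.adjoint = A.closure := by
  have hle : A ≤ A.adjoint := hsym.le_adjoint hA
  have hclosed : A.adjoint.IsClosed := LinearPMap.adjoint_isClosed hA
  have hclosable : A.IsClosable := hclosed.isClosable.leIsClosable hle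
  refine le_antisymm ?_ ?_
  · rw [← LinearPMap.le_graph_iff, ← hclosable.graph_closure_eq_closure_graph]
    set e := (WithLp.linearEquiv 2 ℂ (𝓗 × 𝓗)).symm
    set K := A.graph.map e.toLinearMap
    set M := A.adjoint.graph.map e.toLinearMap with hM
    have hMclosed : _root_.IsClosed (M : Set (WithLp 2 (𝓗 × 𝓗))) := by
      rw [hM, Submodule.map_coe, LinearEquiv.coe_coe, LinearEquiv.image_eq_preimage_symm]
      exact IsClosed.preimage (WithLp.prod_continuous_ofLp 2 _ _) hclosed
    have hKM : K.topologicalClosure ≤ M :=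
      Submodule.topologicalClosure_minimal _
        (Submodule.map_mono (LinearPMap.le_graph_of_le hle)) hMclosed
    have hbot : K.topologicalClosureᗮ ⊓ M = ⊥ := by
      rw [Submodule.orthogonal_closure, eq_bot_iff]
      rintro _ ⟨hKp, ⟨⟨x, y⟩, hp, rfl⟩⟩
      rw [SetLike.mem_coe, LinearPMap.adjoint_graph_eq_graph_adjoint hA,
        Submodule.mem_adjoint_iff] at hp
      have h1 : ∀ u : A.domain, ⟪x, A u⟫_ℂ = ⟪y, (u : 𝓗)⟫_ℂ := fun u => by
        rw [← inner_conj_symm, sub_eq_zero.1 (hp u (A u) (A.mem_graph u)), inner_conj_symm]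
      have h2 : ∀ u : A.domain, ⟪x, (u : 𝓗)⟫_ℂ + ⟪y, A u⟫_ℂ = 0 := fun u => by
        have := (Submodule.mem_orthogonal' K _).1 hKp (e ((u : 𝓗), A u))
          ⟨_, A.mem_graph u, rfl⟩
        simpa [e] using this
      have h3 : ∀ c : ℂ, c * c = -1 → (starRingEnd ℂ) c = -c → y - c • x = 0 := by
        intro c hc hc'
        refine hdef c hc hc' _ fun u => ?_
        simp only [inner_sub_left, inner_smul_left, hc']
        linear_combination c * h1 u + h2 u - ⟪x, (u : 𝓗)⟫_ℂ * hc
      have h4 := h3 Complex.I Complex.I_mul_I Complex.conj_I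
      have h5 := h3 (-Complex.I) (by simp) (by simp)
      have hx : x = 0 := by
        have h : (2 * Complex.I) • x = 0 := calc
          (2 * Complex.I) • x = (y - (-Complex.I) • x) - (y - Complex.I • x) := by module
          _ = 0 := by rw [h4, h5, sub_zero]
        exact (smul_eq_zero.1 h).resolve_left (by simp)
      have hy : y = 0 := by simpa [hx] using h4
      simp [hx, hy]
    have hMK : M = K.topologicalClosure := by
      rw [← Submodule.sup_orthogonal_inf_of_hasOrthogonalProjection hKM, hbot, sup_bot_eq]
    intro p hp
    have hp' : e p ∈ _root_.closure (K : Set (WithLp 2 (𝓗 × 𝓗))) := by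
      have : e p ∈ M := ⟨p, hp, rfl⟩
      rwa [hMK] at this
    refine map_mem_closure (WithLp.prod_continuous_ofLp 2 𝓗 𝓗) hp' ?_
    rintro _ ⟨q, hq, rfl⟩
    exact hq
  · rw [← LinearPMap.le_graph_iff, ← hclosable.graph_closure_eq_closure_graph]
    exact Submodule.topologicalClosure_minimal _ (LinearPMap.le_graph_of_le hle) hclosed


/-- **Linear Fröhlich corollary (realization form).** Let `j : V → 𝓗` be a linear map with
dense range from a complex vector space into a complex Hilbert space, and
`L : V → V` a linear map symmetric with respect to the induced form. If for every `v ∈ V`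
there is `ε > 0` and a curve `γ : [0, ε) → V` starting at `v` such that `t ↦ j (γ t)` is
differentiable with derivative `j (L (γ t))`, then the operator `A` on `j(V)` with
`A (j v) = j (L v)` is well defined, symmetric, and essentially self-adjoint
(its adjoint equals its closure, which is thus self-adjoint). -/
theorem linear_frohlich
    {V : Type*} [AddCommGroup V] [Module ℂ V]
    {𝓗 : Type*} [NormedAddCommGroup 𝓗] [InnerProductSpace ℂ 𝓗] [CompleteSpace 𝓗]
    (j : V →ₗ[ℂ] 𝓗) (hdense : Dense (Set.range j))
    (L : V →ₗ[ℂ] V)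
    (hsym : ∀ v w : V, ⟪j (L v), j w⟫_ℂ = ⟪j v, j (L w)⟫_ℂ)
    (hflow : ∀ v : V, ∃ ε > (0 : ℝ), ∃ γ : ℝ → V, γ 0 = v ∧
      ∀ t ∈ Set.Ico (0 : ℝ) ε,
        HasDerivWithinAt (fun s => j (γ s)) (j (L (γ t))) (Set.Ico 0 ε) t) :
    (∀ v v' : V, j v = j v' → j (L v) = j (L v')) ∧
    ∃ A : 𝓗 →ₗ.[ℂ] 𝓗,
      A.domain = LinearMap.range j ∧
      (∀ v : V, ∀ h : j v ∈ A.domain, A ⟨j v, h⟩ = j (L v)) ∧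
      (∀ u w : A.domain, ⟪A u, (w : 𝓗)⟫_ℂ = ⟪(u : 𝓗), A w⟫_ℂ) ∧
      A.adjoint = A.closure := by
  have hwd : ∀ v, j v = 0 → j (L v) = 0 := fun v hv =>
    hdense.eq_zero_of_inner_left ℂ <| by
      rintro _ ⟨w, rfl⟩
      rw [hsym, hv, inner_zero_left]
  refine ⟨fun v v' h => ?_, ?_⟩
  · rw [← sub_eq_zero, ← map_sub, ← map_sub]
    exact hwd _ (by rw [map_sub, h, sub_self])
  obtain ⟨A, hdom, hAj⟩ : ∃ A : 𝓗 →ₗ.[ℂ] 𝓗, A.domain = LinearMap.range j ∧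
      ∀ v : V, ∀ h : j v ∈ A.domain, A ⟨j v, h⟩ = j (L v) := by
    have hker : LinearMap.ker j ≤ LinearMap.ker (j ∘ₗ L) := fun v hv => hwd v hv
    refine ⟨⟨LinearMap.range j,
      ((LinearMap.ker j).liftQ (j ∘ₗ L) hker) ∘ₗ j.quotKerEquivRange.symm.toLinearMap⟩,
      rfl, fun v h => ?_⟩
    change ((LinearMap.ker j).liftQ (j ∘ₗ L) hker) (j.quotKerEquivRange.symm ⟨j v, h⟩) = _
    rw [LinearMap.quotKerEquivRange_symm_apply_image]
    rfl
  have hmem : ∀ v, j v ∈ A.domain := fun v => hdom ▸ LinearMap.mem_range_self j v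
  have hAsym : ∀ u w : A.domain, ⟪A u, (w : 𝓗)⟫_ℂ = ⟪(u : 𝓗), A w⟫_ℂ := by
    rintro ⟨u, hu⟩ ⟨w, hw⟩
    obtain ⟨v, rfl⟩ := LinearMap.mem_range.1 (hdom ▸ hu)
    obtain ⟨v', rfl⟩ := LinearMap.mem_range.1 (hdom ▸ hw)
    rw [hAj, hAj, hsym]
  have hAdense : Dense (A.domain : Set 𝓗) := by rwa [hdom, LinearMap.coe_range]
  refine ⟨A, hdom, hAj, hAsym, LinearPMap.adjoint_eq_closure_of_deficiency_eq_zero hAdense hAsym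
    fun c hc hc' ψ hψ => eq_zero_of_deficiency hdense hsym hflow hc hc' fun v => ?_⟩
  rw [← hAj v (hmem v), hψ]
end

section
/- Let E be a real Banach space, M ⊆ E an open set, 𝓗 a complex Hilbert space, and k : M → 𝓗 a smooth map whose image is total in 𝓗. Let X : M → E be a smooth vector field, ε ∈ {+1, −1}, and suppose for every m ∈ M there is a differentiable curve γ_m : [0, ε_m) → M with γ_m(0) = m and γ_m'(t) = X(γ_m(t)), such that the kernel K(m,n) := ⟪k(n), k(m)⟫ satisfies (d/dt)|_{t=0} K(γ_m(t), n) = ε · (d/dt)|_{t=0} K(m, γ_n(t)) for all m, n ∈ M. Then for every integral curve γ : [a,b] → M of X, the curve η(t) := k(γ(t)) in 𝓗 is smooth, and for all t ∈ [a,b] and all m ∈ M one has ⟪η'(t), k(m)⟫ = ε · ⟪η(t), v_m⟫, where v_m := (d/dt)|_{t=0} k(γ_m(t)) is the (right) derivative at 0 of k along γ_m. -/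
open scoped InnerProductSpace

/-- An integral curve on `[a, b]` of a smooth vector field is smooth. -/
theorem contDiffOn_integralCurve {E : Type*} [NormedAddCommGroup E] [NormedSpace ℝ E]
    {M : Set E} {X : E → E} (hX : ContDiffOn ℝ (⊤ : ℕ∞) X M) {a b : ℝ} (hab : a < b) {c : ℝ → E}
    (hc : ∀ t ∈ Set.Icc a b, c t ∈ M ∧ HasDerivWithinAt c (X (c t)) (Set.Icc a b) t) :
    ContDiffOn ℝ (⊤ : ℕ∞) c (Set.Icc a b) := by
  rw [contDiffOn_infty]
  intro n
  induction n with
  | zero =>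
    exact contDiffOn_zero.2 fun t ht => (hc t ht).2.continuousWithinAt
  | succ n ih =>
    have hu := uniqueDiffOn_Icc hab
    rw [Nat.cast_succ, contDiffOn_succ_iff_derivWithin hu]
    refine ⟨fun t ht => (hc t ht).2.differentiableWithinAt, by simp, ?_⟩
    exact ((hX.of_le (by exact_mod_cast le_top)).comp ih fun t ht => (hc t ht).1).congr
      fun t ht => (hc t ht).2.derivWithin (hu t ht)

/-- Let `k : M → 𝓗` realize the smooth kernel `K(m, n) = ⟪k n, k m⟫` on an open subset `M`
of a real Banach space, let `X` be a smooth vector field on `M` with integral curves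
`γ m : [0, δ m) → M` through every `m ∈ M`, and assume
`(d/dt)|₀ K(γ m t, n) = ε • (d/dt)|₀ K(m, γ n t)` for a sign `ε ∈ {1, -1}`. Then for every
integral curve `c : [a, b] → M` of `X`, the curve `η t := k (c t)` is smooth, and for all
`t ∈ [a, b]` and `m ∈ M` one has `⟪η' t, k m⟫ = ε * ⟪η t, v m⟫`, where `v m` is the right
derivative at `0` of `t ↦ k (γ m t)`. -/
theorem kernel_ode_lemma
    {E : Type*} [NormedAddCommGroup E] [NormedSpace ℝ E] [CompleteSpace E]
    {𝓗 : Type*} [NormedAddCommGroup 𝓗] [InnerProductSpace ℂ 𝓗] [CompleteSpace 𝓗]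
    (M : Set E) (hM : IsOpen M)
    (k : E → 𝓗) (hk : ContDiffOn ℝ (⊤ : ℕ∞) k M)
    (htotal : Submodule.topologicalClosure (Submodule.span ℂ (k '' M)) = ⊤)
    (X : E → E) (hX : ContDiffOn ℝ (⊤ : ℕ∞) X M)
    (ε : ℂ) (hε : ε = 1 ∨ ε = -1)
    (γ : E → ℝ → E) (δ : E → ℝ)
    (hcurve : ∀ m ∈ M, 0 < δ m ∧ γ m 0 = m ∧
      ∀ t ∈ Set.Ico (0 : ℝ) (δ m), γ m t ∈ M ∧
        HasDerivWithinAt (γ m) (X (γ m t)) (Set.Ico 0 (δ m)) t)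
    (hker : ∀ m ∈ M, ∀ n ∈ M, ∃ a b : ℂ,
      HasDerivWithinAt (fun t => ⟪k n, k (γ m t)⟫_ℂ) a (Set.Ici 0) 0 ∧
      HasDerivWithinAt (fun t => ⟪k (γ n t), k m⟫_ℂ) b (Set.Ici 0) 0 ∧
      a = ε * b)
    (a b : ℝ) (hab : a ≤ b) (c : ℝ → E)
    (hc : ∀ t ∈ Set.Icc a b, c t ∈ M ∧ HasDerivWithinAt c (X (c t)) (Set.Icc a b) t) :
    ContDiffOn ℝ (⊤ : ℕ∞) (fun t => k (c t)) (Set.Icc a b) ∧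
    ∃ η' : ℝ → 𝓗,
      (∀ t ∈ Set.Icc a b, HasDerivWithinAt (fun s => k (c s)) (η' t) (Set.Icc a b) t) ∧
      ∀ m ∈ M, ∃ v : 𝓗,
        HasDerivWithinAt (fun s => k (γ m s)) v (Set.Ici 0) 0 ∧
        ∀ t ∈ Set.Icc a b, ⟪η' t, k m⟫_ℂ = ε * ⟪k (c t), v⟫_ℂ := by
  have hε2 : ε * ε = 1 := by rcases hε with rfl | rfl <;> norm_num
  have hkd : ∀ m ∈ M, HasFDerivAt k (fderiv ℝ k m) m := fun m hm =>
    ((hk.contDiffAt (hM.mem_nhds hm)).differentiableAt (by simp)).hasFDerivAt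
  have hv : ∀ m ∈ M,
      HasDerivWithinAt (fun s => k (γ m s)) (fderiv ℝ k m (X m)) (Set.Ici 0) 0 := by
    intro m hm
    obtain ⟨hδ, h0, hγ⟩ := hcurve m hm
    have h1 := (hγ 0 ⟨le_rfl, hδ⟩).2
    have h2 : HasFDerivAt k (fderiv ℝ k m) (γ m 0) := by rw [h0]; exact hkd m hm
    have h3 := h2.comp_hasDerivWithinAt (0 : ℝ) h1
    rw [h0] at h3
    exact h3.mono_of_mem_nhdsWithin (Ico_mem_nhdsGE hδ)
  refine ⟨?_, fun t => fderiv ℝ k (c t) (X (c t)), fun t ht =>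
    (hkd (c t) (hc t ht).1).comp_hasDerivWithinAt t (hc t ht).2, fun m hm =>
    ⟨fderiv ℝ k m (X m), hv m hm, fun t ht => ?_⟩⟩
  · rcases hab.eq_or_lt with rfl | hlt
    · rw [Set.Icc_self]
      exact (contDiffOn_const (c := k (c a))).congr (by simp)
    · exact hk.comp (contDiffOn_integralCurve hX hlt hc) fun t ht => (hc t ht).1
  · have hn := (hc t ht).1
    obtain ⟨p, q, hp, hq, hpq⟩ := hker m hm (c t) hn
    have hu : UniqueDiffWithinAt ℝ (Set.Ici (0 : ℝ)) 0 := uniqueDiffOn_Ici 0 0 Set.self_mem_Ici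
    have hp' := (hasDerivWithinAt_const (0 : ℝ) (Set.Ici 0) (k (c t))).inner ℂ (hv m hm)
    have hq' := (hv (c t) hn).inner ℂ (hasDerivWithinAt_const (0 : ℝ) (Set.Ici 0) (k m))
    have ep := hu.eq_deriv _ hp hp'
    have eq := hu.eq_deriv _ hq hq'
    rw [(hcurve (c t) hn).2.1] at eq
    simp only [inner_zero_left, inner_zero_right, add_zero, zero_add] at ep eq
    rw [← ep, hpq, ← mul_assoc, hε2, one_mul, eq]
end
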